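/- arXiv:2407.09403 — 3 statements merged into one kernel-verified Lean document; each statement's English description precedes it below -/
import Mathlib

section
/- For any partial k-edge-coloring φ of a multigraph G and any ordered tree T in G, any two closures of T under φ have the same vertex set; that is, V(cl_φ(T)) is uniquely determined by T and φ. -/
open scoped Classical

/-- A loopless multigraph on vertex type `V` with edge type `E`:
each edge has an unordered pair of distinct ends. -/
structure Multigraph (V : Type) (E : Type) where
  ends : E → Sym2 V
  loopless : ∀ e, ¬ (ends e).IsDiag

/-- A path datum: a list of edges together with the list of visited vertices. -/
structure EPath (V : Type) (E : Type) where
  edges : List E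
  verts : List V

/-- The raw data of a Tashkinov tree: parameters `(n, m, q+1)`, the base/stages
`stage 0, …, stage n`, the connecting colors `δf 0, …, δf n`, the levels
`level 0, …, level m` with `δ_n`-extending edges `lext`, the phases
`phase 0, …, phase q` with phase-extending edges `pext` and reserved color sets `Γf`,
the full last phase `full` and the Tashkinov tree `tree` itself. -/
structure TashkinovData (V : Type) (E : Type) where
  n : ℕ
  m : ℕ
  q : ℕ
  stage : ℕ → List E
  δf : ℕ → ℕ
  level : ℕ → List E
  lext : ℕ → E
  phase : ℕ → List E
  pext : ℕ → E
  Γf : ℕ → ℕ → Set ℕ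
  full : List E
  tree : List E

/-- The set `S_n = {δ_0, …, δ_n}` of connecting colors. -/
def TashkinovData.Sn {V E : Type} (D : TashkinovData V E) : Set ℕ :=
  {c | ∃ i ≤ D.n, D.δf i = c}

/-- Swap the colors `α` and `β`. -/
def swapColor (α β : ℕ) : Option ℕ → Option ℕ := fun c =>
  if c = some α then some β else if c = some β then some α else c

/-- Strict lexicographic order on triples. -/
def lex3Lt (a b : ℕ × ℕ × ℕ) : Prop :=
  a.1 < b.1 ∨ (a.1 = b.1 ∧ (a.2.1 < b.2.1 ∨ (a.2.1 = b.2.1 ∧ a.2.2 < b.2.2)))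

def lex3Le (a b : ℕ × ℕ × ℕ) : Prop := lex3Lt a b ∨ a = b

/-- Strict lexicographic order on quintuples. -/
def lex5Lt (a b : ℕ × ℕ × ℕ × ℕ × ℕ) : Prop :=
  a.1 < b.1 ∨ (a.1 = b.1 ∧ (a.2.1 < b.2.1 ∨ (a.2.1 = b.2.1 ∧
    (a.2.2.1 < b.2.2.1 ∨ (a.2.2.1 = b.2.2.1 ∧
      (a.2.2.2.1 < b.2.2.2.1 ∨ (a.2.2.2.1 = b.2.2.2.1 ∧
        a.2.2.2.2 < b.2.2.2.2)))))))

namespace Multigraph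

variable {V E : Type} [Fintype V] [Fintype E] [DecidableEq V] [DecidableEq E]
variable (G : Multigraph V E) {k : ℕ}

/-- The degree of a vertex: the number of incident edges. -/
noncomputable def degree (v : V) : ℕ :=
  (Finset.univ.filter fun e : E => v ∈ G.ends e).card

/-- The maximum degree `Δ(G)`. -/
noncomputable def maxDegree : ℕ := Finset.univ.sup G.degree

/-- `(U, F)` is a subgraph: every end of an edge of `F` lies in `U`. -/
def IsSub (p : Finset V × Finset E) : Prop :=
  ∀ e ∈ p.2, ∀ v, v ∈ G.ends e → v ∈ p.1

/-- `Γ(G) = max{⌈2|E(H)|/(|V(H)|−1)⌉ : H ⊆ G, |V(H)| odd, |V(H)| ≥ 3}`. -/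
noncomputable def gamma : ℕ :=
  Finset.univ.sup fun p : Finset V × Finset E =>
    if G.IsSub p ∧ Odd p.1.card ∧ 3 ≤ p.1.card then
      ⌈(2 * (p.2.card : ℚ)) / ((p.1.card : ℚ) - 1)⌉₊
    else 0

/-- `max {Δ(G) + 1, Γ(G)}`. -/
noncomputable def goldbergBound : ℕ := max (G.maxDegree + 1) G.gamma

/-- Two edges are incident: they share an end. -/
def EAdj (e f : E) : Prop := ∃ v, v ∈ G.ends e ∧ v ∈ G.ends f

/-- A proper edge coloring of all of `G` with colors in `[k] = {1, …, k}`. -/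
def IsProperColoring (k : ℕ) (c : E → ℕ) : Prop :=
  (∀ e, c e ∈ Finset.Icc 1 k) ∧ ∀ e f, e ≠ f → G.EAdj e f → c e ≠ c f

/-- The chromatic index `χ'(G)`. -/
noncomputable def chromaticIndex : ℕ := sInf {k | ∃ c : E → ℕ, G.IsProperColoring k c}

/-- A partial edge coloring of `G` with colors in `[k] = {1, …, k}`:
edges in the support get colors, incident edges get distinct colors. -/
structure PartialColoring (G : Multigraph V E) (k : ℕ) where
  map : E → Option ℕ
  mem_Icc : ∀ e c, map e = some c → c ∈ Finset.Icc 1 k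
  proper : ∀ e f c, e ≠ f → G.EAdj e f → map e = some c → map f ≠ some c

namespace PartialColoring

variable {G}

/-- `φ̄(v)`: the set of colors of `[k]` missing at `v`. -/
def missing (φ : G.PartialColoring k) (v : V) : Set ℕ :=
  {c | c ∈ Finset.Icc 1 k ∧ ∀ e, v ∈ G.ends e → φ.map e ≠ some c}

/-- `φ̄(S) = ⋃_{v ∈ S} φ̄(v)`. -/
def missingOn (φ : G.PartialColoring k) (S : Set V) : Set ℕ :=
  ⋃ v ∈ S, φ.missing v

/-- The support of a partial coloring. -/
def support (φ : G.PartialColoring k) : Set E := {e | φ.map e ≠ none}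

/-- The set of colors appearing on a set of edges. -/
def colorsOn (φ : G.PartialColoring k) (S : Set E) : Set ℕ :=
  {c | ∃ e ∈ S, φ.map e = some c}

/-- The set of edges colored `α` or `β`. -/
def twoColored (φ : G.PartialColoring k) (α β : ℕ) : Set E :=
  {e | φ.map e = some α ∨ φ.map e = some β}

/-- The map obtained from `φ` by swapping the colors `α, β` on the edge set `R`. -/
noncomputable def swapMap (φ : G.PartialColoring k) (α β : ℕ) (R : Set E) : E → Option ℕ :=
  fun e => if e ∈ R then swapColor α β (φ.map e) else φ.map e

end PartialColoring

/-- The vertex set of (the trees spanned by) a list of edges. -/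
def treeVerts (l : List E) : Set V := {v | ∃ e ∈ l, v ∈ G.ends e}

/-- `∂X`: the set of edges with exactly one end in `X`. -/
def boundary (X : Set V) : Set E :=
  {e | ∃ u w, G.ends e = s(u, w) ∧ u ∈ X ∧ w ∉ X}

/-- An ordered tree: a nonempty duplicate-free list of edges each of whose
initial segments spans a tree (each new edge has exactly one end in the
current vertex set). -/
def IsOrderedTree (l : List E) : Prop :=
  l ≠ [] ∧ l.Nodup ∧
    ∀ i (hi : i < l.length), 0 < i →
      ∃! v, v ∈ G.ends (l.get ⟨i, hi⟩) ∧ v ∈ G.treeVerts (l.take i)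

/-- A set of vertices is `φ`-elementary if missing color sets are pairwise disjoint. -/
def IsElemOn (φ : G.PartialColoring k) (S : Set V) : Prop :=
  ∀ u ∈ S, ∀ v ∈ S, u ≠ v → φ.missing u ∩ φ.missing v = ∅

/-- A tree is `φ`-elementary. -/
def IsElemTree (φ : G.PartialColoring k) (T : List E) : Prop :=
  G.IsElemOn φ (G.treeVerts T)

/-- A tree is `φ`-closed: no color missing on the tree appears on its boundary. -/
def IsClosedTree (φ : G.PartialColoring k) (T : List E) : Prop :=
  ∀ e ∈ G.boundary (G.treeVerts T), ∀ c, φ.map e = some c →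
    c ∉ φ.missingOn (G.treeVerts T)

/-- `L` is a closure `cl_φ(T)` of `T` under `φ`: an ordered tree with prefix `T`,
obtained by repeatedly appending edges whose color is missing at some current
vertex, maximal with this property. -/
def IsClosureOf (φ : G.PartialColoring k) (T L : List E) : Prop :=
  G.IsOrderedTree L ∧ L.take T.length = T ∧
  (∀ i (hi : i < L.length), T.length ≤ i →
    ∃ c, φ.map (L.get ⟨i, hi⟩) = some c ∧
      c ∈ φ.missingOn (G.treeVerts (L.take i))) ∧
  (∀ e, e ∉ L → ¬ ∃ c, φ.map e = some c ∧ c ∈ φ.missingOn (G.treeVerts L) ∧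
      (∃! v, v ∈ G.ends e ∧ v ∈ G.treeVerts L))

/-- Adjacency within the `(α, β)`-colored subgraph. -/
def compAdj (φ : G.PartialColoring k) (α β : ℕ) (e f : E) : Prop :=
  e ∈ φ.twoColored α β ∧ f ∈ φ.twoColored α β ∧ G.EAdj e f

/-- The component of the `(α, β)`-colored subgraph containing the edge `e₀`. -/
def component (φ : G.PartialColoring k) (α β : ℕ) (e₀ : E) : Set E :=
  {e | e ∈ φ.twoColored α β ∧ Relation.ReflTransGen (G.compAdj φ α β) e₀ e}

/-- A Kempe exchange: swap two colors on a component of the two-colored subgraph. -/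
def KempeStep (φ φ' : G.PartialColoring k) : Prop :=
  ∃ α β e₀, α ∈ Finset.Icc 1 k ∧ β ∈ Finset.Icc 1 k ∧
    e₀ ∈ φ.twoColored α β ∧
    φ'.map = φ.swapMap α β (G.component φ α β e₀)

/-- Kempe equivalence: generated by Kempe exchanges. -/
def KempeEquiv (φ φ' : G.PartialColoring k) : Prop :=
  Relation.ReflTransGen (fun a b => G.KempeStep a b) φ φ'

/-- `p` is a path in `G`: distinct vertices `v₀, …, v_r` with `edges i` joining
`v_i` and `v_{i+1}`. -/
def IsEPath (p : EPath V E) : Prop :=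
  p.verts.Nodup ∧ p.verts.length = p.edges.length + 1 ∧
  ∀ i (h1 : i < p.edges.length) (h2 : i < p.verts.length) (h3 : i + 1 < p.verts.length),
    G.ends (p.edges.get ⟨i, h1⟩) = s(p.verts.get ⟨i, h2⟩, p.verts.get ⟨i + 1, h3⟩)

/-- An `(α, β)`-chain: a component of the `(α, β)`-colored subgraph that is a path. -/
def IsChain (φ : G.PartialColoring k) (α β : ℕ) (p : EPath V E) : Prop :=
  G.IsEPath p ∧ (∀ e ∈ p.edges, e ∈ φ.twoColored α β) ∧
  ∀ f ∈ φ.twoColored α β, (∃ u ∈ p.verts, u ∈ G.ends f) → f ∈ p.edges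

/-- `P_v(α, β; φ)`: the `(α, β)`-chain containing `v`. -/
def IsChainAt (φ : G.PartialColoring k) (α β : ℕ) (v : V) (p : EPath V E) : Prop :=
  G.IsChain φ α β p ∧ v ∈ p.verts

/-- A `(T, φ, α, β)`-exit path. -/
def IsExitPath (φ : G.PartialColoring k) (T : List E) (α β : ℕ) (p : EPath V E) : Prop :=
  G.IsEPath p ∧ p.edges ≠ [] ∧ (∀ e ∈ p.edges, e ∈ φ.twoColored α β) ∧
  (∃ u, p.verts.head? = some u ∧ u ∈ G.treeVerts T) ∧
  (∀ w ∈ p.verts.tail, w ∉ G.treeVerts T) ∧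
  (∃ v, p.verts.getLast? = some v ∧ (φ.missing v ∩ {α, β}).Nonempty)

/-- A `(T, φ, α, β)`-exit edge. -/
def IsExitEdge (φ : G.PartialColoring k) (T : List E) (α β : ℕ) (e : E) : Prop :=
  ∃ p, G.IsExitPath φ T α β p ∧ p.edges.head? = some e

/-- A `(T, φ, α, β)`-nonexit edge. -/
def IsNonexitEdge (φ : G.PartialColoring k) (T : List E) (α β : ℕ) (e : E) : Prop :=
  e ∈ G.boundary (G.treeVerts T) ∧ e ∈ φ.twoColored α β ∧
  ¬ G.IsExitEdge φ T α β e

/-- A `(T, φ, α, β)`-path: a path in the `(α, β)`-colored subgraph with both ends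
in `V(T)` and otherwise disjoint from `T`. -/
def IsTPath (φ : G.PartialColoring k) (T : List E) (α β : ℕ) (p : EPath V E) : Prop :=
  G.IsEPath p ∧ p.edges ≠ [] ∧ (∀ e ∈ p.edges, e ∈ φ.twoColored α β) ∧
  (∃ u, p.verts.head? = some u ∧ u ∈ G.treeVerts T) ∧
  (∃ v, p.verts.getLast? = some v ∧ v ∈ G.treeVerts T) ∧
  (∀ w ∈ p.verts.tail.dropLast, w ∉ G.treeVerts T)

end Multigraph

/-- `l` is the edge list of a nonexit path obtained from the `T`-path `p` by
removing one end vertex, ordered starting from the edge incident with `T`. -/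
def IsNonexitEdgeList {V E : Type} (p : EPath V E) (l : List E) : Prop :=
  l = p.edges.dropLast ∨ l = p.edges.tail.reverse

namespace Multigraph

variable {V E : Type} [Fintype V] [Fintype E] [DecidableEq V] [DecidableEq E]
variable (G : Multigraph V E) {k : ℕ}

/-- `T' = T⁺(φ, α, δ)`: obtained from `T` by adding one nonexit path for each
`(T, φ, α, δ)`-path, the edges of each added path appearing consecutively. -/
def IsAugmented (φ : G.PartialColoring k) (T : List E) (α δc : ℕ) (T' : List E) : Prop :=
  G.IsOrderedTree T' ∧
  ∃ (ps : List (EPath V E)) (ls : List (List E)),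
    (∀ p ∈ ps, G.IsTPath φ T α δc p) ∧
    List.Pairwise (fun p q => ∀ e ∈ p.edges, e ∉ q.edges) ps ∧
    (∀ p', G.IsTPath φ T α δc p' → ∃ p ∈ ps, ∃ e ∈ p'.edges, e ∈ p.edges) ∧
    ls.length = ps.length ∧
    (∀ i (h1 : i < ps.length) (h2 : i < ls.length),
      IsNonexitEdgeList (ps.get ⟨i, h1⟩) (ls.get ⟨i, h2⟩)) ∧
    T' = T ++ ls.flatten

/-- The data of an `(n,0,0)`-tree: base `stage 0 = cl_φ(G[g])`, stages
`stage 1, …, stage n`, connecting colors `δf 0, …, δf n`. -/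
def IsStageSystem (φ : G.PartialColoring k) (g : E) (α₀ : ℕ) (n : ℕ)
    (stage : ℕ → List E) (δf : ℕ → ℕ) : Prop :=
  G.IsClosureOf φ [g] (stage 0) ∧
  (∀ i ≤ n, δf i ∈ Finset.Icc 1 k ∧
    ∃ e₁ e₂, e₁ ≠ e₂ ∧ e₁ ∈ G.boundary (G.treeVerts (stage i)) ∧
      e₂ ∈ G.boundary (G.treeVerts (stage i)) ∧
      φ.map e₁ = some (δf i) ∧ φ.map e₂ = some (δf i)) ∧
  ∀ i < n, ∃ Tp : List E, G.IsAugmented φ (stage i) α₀ (δf i) Tp ∧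
    G.IsClosureOf φ Tp (stage (i + 1))

/-- A `δ_n`-extending edge for the current level `Tcur`. -/
def IsLevelExtEdge (φ : G.PartialColoring k) (Tn Tcur : List E) (α₀ δn : ℕ) (e : E) : Prop :=
  e ∈ G.boundary (G.treeVerts Tcur) ∧ φ.map e = some δn ∧
  ∃ p, G.IsTPath φ Tn α₀ δn p ∧
    ∃ (j : ℕ) (hj : j < p.edges.length), p.edges.get ⟨j, hj⟩ = e ∧
      ∀ j' (hj' : j' < p.edges.length), j' < j →
        ∀ v ∈ G.ends (p.edges.get ⟨j', hj'⟩), v ∈ G.treeVerts Tcur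

/-- The data of an `(n,m,0)`-tree: stages plus levels `level 0 = stage n, …, level m`. -/
def IsLevelSystem (φ : G.PartialColoring k) (g : E) (α₀ : ℕ) (n m : ℕ)
    (stage : ℕ → List E) (δf : ℕ → ℕ) (level : ℕ → List E) (lext : ℕ → E) : Prop :=
  G.IsStageSystem φ g α₀ n stage δf ∧ level 0 = stage n ∧
  ∀ i < m, G.IsLevelExtEdge φ (stage n) (level i) α₀ (δf n) (lext i) ∧
    G.IsClosureOf φ (level i ++ [lext i]) (level (i + 1))

/-- The conditions on the initial reserved color sets `Γ₀(δ)`. -/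
def GammaBase (φ : G.PartialColoring k) (g : E) (Sn : Set ℕ) (P0 : List E)
    (Γ0 : ℕ → Set ℕ) : Prop :=
  (∀ c ∈ Sn, c ∉ φ.missingOn (G.treeVerts P0) →
    Γ0 c ⊆ φ.missingOn (G.treeVerts P0) \ φ.missingOn {x | x ∈ G.ends g} ∧
    (Γ0 c).ncard = 2) ∧
  ∀ c ∈ Sn, ∀ c' ∈ Sn, c ≠ c' → c ∉ φ.missingOn (G.treeVerts P0) →
    c' ∉ φ.missingOn (G.treeVerts P0) → Γ0 c ∩ Γ0 c' = ∅

/-- `Tnext` is obtained from `Tcur + gcur` by adding edges subject to (b1), (b2)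
of the definition of phases. -/
def PhaseStep (φ : G.PartialColoring k) (Sn : Set ℕ) (Γi : ℕ → Set ℕ)
    (Tcur : List E) (gcur : E) (Tnext : List E) : Prop :=
  G.IsOrderedTree Tnext ∧ Tnext.take (Tcur.length + 1) = Tcur ++ [gcur] ∧
  (∀ j (hj : j < Tnext.length), Tcur.length + 1 ≤ j →
    ∃ c, φ.map (Tnext.get ⟨j, hj⟩) = some c ∧
      c ∈ φ.missingOn (G.treeVerts (Tnext.take j)) ∧
      ∀ δ' ∈ Sn, δ' ∉ φ.missingOn (G.treeVerts Tcur) → c ∈ Γi δ' →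
        δ' ∈ φ.missingOn (G.treeVerts (Tnext.take j))) ∧
  (∀ e ∈ G.boundary (G.treeVerts Tnext), ∀ c, φ.map e = some c →
    c ∈ φ.missingOn (G.treeVerts Tnext) →
    ∃ δ' ∈ Sn, δ' ∉ φ.missingOn (G.treeVerts Tnext) ∧ c ∈ Γi δ')

/-- The phase-extending edge `gcur = g_{n,m,i}` together with the update of the
reserved color sets `Γ`. -/
def IsPhaseExtStep (φ : G.PartialColoring k) (Sn : Set ℕ) (δn : ℕ)
    (Γprev Γnew : ℕ → Set ℕ) (Pprev Pcur : List E) (gcur : E) : Prop :=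
  gcur ∈ G.boundary (G.treeVerts Pcur) ∧
  ∃ δi ∈ Sn, δi ∉ φ.missingOn (G.treeVerts Pcur) ∧
    (∃ c, φ.map gcur = some c ∧ c ∈ Γprev δi ∧
      ∃ γi, γi ∈ φ.missingOn (G.treeVerts Pcur \ G.treeVerts Pprev) ∧ γi ≠ δn ∧
        Γnew δi = (Γprev δi ∪ {γi}) \ {c}) ∧
    ∀ c', c' ≠ δi → Γnew c' = Γprev c'

/-- The data of an `(n,m,q)`-tree (`q ≥ 1`): levels plus phases
`phase 0 = level m, phase 1, …, phase q`. -/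
def IsPhaseSystem (φ : G.PartialColoring k) (g : E) (α₀ : ℕ) (n m q : ℕ)
    (stage : ℕ → List E) (δf : ℕ → ℕ) (level : ℕ → List E) (lext : ℕ → E)
    (phase : ℕ → List E) (pext : ℕ → E) (Γf : ℕ → ℕ → Set ℕ) : Prop :=
  G.IsLevelSystem φ g α₀ n m stage δf level lext ∧
  G.IsLevelExtEdge φ (stage n) (level m) α₀ (δf n) (lext m) ∧
  phase 0 = level m ∧ pext 0 = lext m ∧
  G.GammaBase φ g {c | ∃ i ≤ n, δf i = c} (phase 0) (Γf 0) ∧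
  (∀ i, 1 ≤ i → i < q →
    G.IsPhaseExtStep φ {c | ∃ i' ≤ n, δf i' = c} (δf n) (Γf (i - 1)) (Γf i)
      (phase (i - 1)) (phase i) (pext i)) ∧
  ∀ i < q, G.PhaseStep φ {c | ∃ i' ≤ n, δf i' = c} (Γf i) (phase i) (pext i) (phase (i + 1))

/-- The data of an `(n,m,q+1)`-Tashkinov tree `tree`: a prefix of the
`(n,m,q+1)`-tree `full` properly containing the final phase `phase q`. -/
def IsTashkinovSystem (φ : G.PartialColoring k) (g : E) (α₀ : ℕ) (n m q : ℕ)
    (stage : ℕ → List E) (δf : ℕ → ℕ) (level : ℕ → List E) (lext : ℕ → E)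
    (phase : ℕ → List E) (pext : ℕ → E) (Γf : ℕ → ℕ → Set ℕ)
    (full tree : List E) : Prop :=
  G.IsPhaseSystem φ g α₀ n m q stage δf level lext phase pext Γf ∧
  (1 ≤ q → G.IsPhaseExtStep φ {c | ∃ i ≤ n, δf i = c} (δf n) (Γf (q - 1)) (Γf q)
    (phase (q - 1)) (phase q) (pext q)) ∧
  G.PhaseStep φ {c | ∃ i ≤ n, δf i = c} (Γf q) (phase q) (pext q) full ∧
  ∃ j, (phase q).length < j ∧ tree = full.take j

/-- `D.tree` is an `(D.n, D.m, D.q + 1)`-Tashkinov tree under `φ` with data `D`. -/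
def IsTashkinov (φ : G.PartialColoring k) (g : E) (α₀ : ℕ) (D : TashkinovData V E) : Prop :=
  G.IsTashkinovSystem φ g α₀ D.n D.m D.q D.stage D.δf D.level D.lext D.phase D.pext
    D.Γf D.full D.tree

/-- `T` is an `(n, m, q)`-tree under `φ`. -/
def IsNMQTree (φ : G.PartialColoring k) (g : E) (α₀ : ℕ) (n m q : ℕ) (T : List E) : Prop :=
  (m = 0 ∧ q = 0 ∧ ∃ (stage : ℕ → List E) (δf : ℕ → ℕ),
    G.IsStageSystem φ g α₀ n stage δf ∧ T = stage n) ∨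
  (0 < m ∧ q = 0 ∧ ∃ (stage : ℕ → List E) (δf : ℕ → ℕ) (level : ℕ → List E) (lext : ℕ → E),
    G.IsLevelSystem φ g α₀ n m stage δf level lext ∧ T = level m) ∨
  (0 < q ∧ ∃ (stage : ℕ → List E) (δf : ℕ → ℕ) (level : ℕ → List E) (lext : ℕ → E)
    (phase : ℕ → List E) (pext : ℕ → E) (Γf : ℕ → ℕ → Set ℕ),
    G.IsPhaseSystem φ g α₀ n m q stage δf level lext phase pext Γf ∧ T = phase q)

/-- The final phase `D.phase D.q` is an `(D.n, D.m, D.q)`-tree under `φ`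
with the same data `D`. -/
def IsNMQSystem (φ : G.PartialColoring k) (g : E) (α₀ : ℕ) (D : TashkinovData V E) : Prop :=
  (D.q = 0 ∧ D.m = 0 ∧ G.IsStageSystem φ g α₀ D.n D.stage D.δf) ∨
  (D.q = 0 ∧ 0 < D.m ∧ G.IsLevelSystem φ g α₀ D.n D.m D.stage D.δf D.level D.lext) ∨
  (0 < D.q ∧ G.IsPhaseSystem φ g α₀ D.n D.m D.q D.stage D.δf D.level D.lext D.phase D.pext D.Γf)

/-- A list of edges is the edge list of a path of `G`. -/
def IsPathList (l : List E) : Prop := ∃ p : EPath V E, G.IsEPath p ∧ p.edges = l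

/-- The index of the first edge of `branch(T)`: the least `j` past the final phase
such that the remaining edges form a path. This equals `t(T)`, the number of edges
of `trunk(T)`; `b(T)` is the number of remaining edges. -/
noncomputable def branchStart (Pq tree : List E) : ℕ :=
  sInf {j | Pq.length ≤ j ∧ G.IsPathList (tree.drop j)}

/-- The measure `(s(T), ℓ(T), p(T), t(T), b(T))` of a Tashkinov tree. -/
noncomputable def measureOf (D : TashkinovData V E) : ℕ × ℕ × ℕ × ℕ × ℕ :=
  (D.n, D.m, D.q + 1, G.branchStart (D.phase D.q) D.tree,
    D.tree.length - G.branchStart (D.phase D.q) D.tree)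

/-- `T(v)`: the minimal prefix of the ordered tree `T` containing `v`. -/
noncomputable def prefixTo (T : List E) (v : V) : List E :=
  T.take (sInf {i | v ∈ G.treeVerts (T.take i)})

/-- `u` is the last vertex of the ordered tree `l`. -/
def IsLastVertexOf (l : List E) (u : V) : Prop :=
  ∃ e, l.getLast? = some e ∧ u ∈ G.ends e ∧ u ∉ G.treeVerts l.dropLast

/-- `Γ_i = ⋃_{δ ∈ S_n \ φ̄(T_{n,m,i})} Γ_i(δ)`. -/
def GammaSet (φ : G.PartialColoring k) (D : TashkinovData V E) (i : ℕ) : Set ℕ :=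
  ⋃ δ' ∈ {δ' | δ' ∈ D.Sn ∧ δ' ∉ φ.missingOn (G.treeVerts (D.phase i))}, D.Γf i δ'

/-- `B(T(u)⁻, φ)`: colors in `φ̄(T(u)⁻)` avoiding `φ̄(g)`, `φ(T(u) − E(T_n))`,
`⋃_{δ ∈ S_n \ φ̄(T(u)⁻)} Γ_q(δ)` and `S_n \ φ̄(T_{n,m,q})`. -/
noncomputable def Bset (φ : G.PartialColoring k) (g : E) (D : TashkinovData V E)
    (u : V) : Set ℕ :=
  {c | c ∈ φ.missingOn (G.treeVerts (G.prefixTo D.tree u).dropLast) ∧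
    c ∉ φ.missingOn {x | x ∈ G.ends g} ∧
    c ∉ φ.colorsOn {e | e ∈ G.prefixTo D.tree u ∧ e ∉ D.stage D.n} ∧
    c ∉ (⋃ δ' ∈ {δ' | δ' ∈ D.Sn ∧
        δ' ∉ φ.missingOn (G.treeVerts (G.prefixTo D.tree u).dropLast)}, D.Γf D.q δ') ∧
    ¬ (c ∈ D.Sn ∧ c ∉ φ.missingOn (G.treeVerts (D.phase D.q)))}

/-- The subgraph of the tree induced on the vertex set `X` is a path covering `X`. -/
def IsInducedPath (tr : List E) (X : Set V) : Prop :=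
  ∃ p : EPath V E, G.IsEPath p ∧ {v | v ∈ p.verts} = X ∧
    ∀ e, e ∈ p.edges ↔ (e ∈ tr ∧ ∀ x ∈ G.ends e, x ∈ X)

/-- A quadruple `(G, g, φ, α₀)`: an uncolored edge `g`, a partial
`k`-edge-coloring of `G − g` with `k = max{Δ(G)+1, Γ(G)}` and `α₀ ∈ φ̄(g)`. -/
structure Quadruple (G : Multigraph V E) where
  g : E
  φ : G.PartialColoring G.goldbergBound
  α₀ : ℕ
  g_uncolored : φ.map g = none
  α₀_missing : α₀ ∈ φ.missingOn {x | x ∈ G.ends g}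

/-- There are a Tashkinov tree `T'` and a coloring `φ'` Kempe equivalent to `φ`
such that `T'` is not `φ'`-elementary and
`(s(T'),ℓ(T'),p(T'),t(T'),b(T')) < (s(T),ℓ(T),p(T),t(T),b(T))` lexicographically. -/
def ReducesBelow (Q : Quadruple G) (D : TashkinovData V E) : Prop :=
  ∃ (D' : TashkinovData V E) (φ' : G.PartialColoring G.goldbergBound),
    G.KempeEquiv Q.φ φ' ∧ G.IsTashkinov φ' Q.g Q.α₀ D' ∧
    ¬ G.IsElemTree φ' D'.tree ∧ lex5Lt (G.measureOf D') (G.measureOf D)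

end Multigraph

namespace Multigraph

variable {V E : Type} (G : Multigraph V E)

/-- The vertex set of a list of edges grows with the list. -/
theorem treeVerts_mono {l l' : List E} (h : l ⊆ l') : G.treeVerts l ⊆ G.treeVerts l' := by
  rintro v ⟨e, he, hv⟩
  exact ⟨e, h he, hv⟩

variable {G} {k : ℕ}

theorem PartialColoring.missingOn_mono (φ : G.PartialColoring k) {S S' : Set V} (h : S ⊆ S') :
    φ.missingOn S ⊆ φ.missingOn S' :=
  Set.biUnion_subset_biUnion_left h

/-- An edge that touches a closure and whose color is missing on it has both ends in it. -/
theorem IsClosureOf.mem_treeVerts_of_mem_ends {φ : G.PartialColoring k} {T L : List E}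
    (h : G.IsClosureOf φ T L) {e : E} {c : ℕ} (hc : φ.map e = some c)
    (hmiss : c ∈ φ.missingOn (G.treeVerts L)) {v w : V} (hv : v ∈ G.ends e)
    (hvL : v ∈ G.treeVerts L) (hw : w ∈ G.ends e) : w ∈ G.treeVerts L := by
  by_cases he : e ∈ L
  · exact ⟨e, he, hw⟩
  by_contra hwL
  refine h.2.2.2 e he ⟨c, hc, hmiss, v, ⟨hv, hvL⟩, ?_⟩
  rintro u ⟨hu, huL⟩
  have hvw : v ≠ w := fun hvw => hwL (hvw ▸ hvL)
  rw [(Sym2.mem_and_mem_iff hvw).1 ⟨hv, hw⟩, Sym2.mem_iff] at hu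
  exact hu.resolve_right fun huw => hwL (huw ▸ huL)

/-- The vertex set of one closure is contained in that of any other. -/
theorem IsClosureOf.treeVerts_subset {φ : G.PartialColoring k} {T L₁ L₂ : List E}
    (hT : T ≠ []) (h₁ : G.IsClosureOf φ T L₁) (h₂ : G.IsClosureOf φ T L₂) :
    G.treeVerts L₁ ⊆ G.treeVerts L₂ := by
  suffices H : ∀ i, T.length ≤ i → G.treeVerts (L₁.take i) ⊆ G.treeVerts L₂ by
    simpa only [List.take_of_length_le (le_max_right T.length L₁.length)] using
      H (max T.length L₁.length) (le_max_left _ _)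
  intro i hi
  induction i, hi using Nat.le_induction with
  | base =>
    rw [h₁.2.1, ← h₂.2.1]
    exact G.treeVerts_mono (List.take_subset _ _)
  | succ i hi ih =>
    rcases lt_or_ge i L₁.length with hlt | hge
    · rintro w ⟨e, he, hw⟩
      rw [List.take_succ_eq_append_getElem hlt, List.mem_append, List.mem_singleton] at he
      rcases he with he | rfl
      · exact ih ⟨e, he, hw⟩
      obtain ⟨c, hc, hmiss⟩ := h₁.2.2.1 i hlt hi
      obtain ⟨v, ⟨hv, hvL⟩, -⟩ :=
        h₁.1.2.2 i hlt ((List.length_pos_iff.2 hT).trans_le hi)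
      exact h₂.mem_treeVerts_of_mem_ends hc (φ.missingOn_mono ih hmiss) hv (ih hvL) hw
    · rw [List.take_of_length_le (hge.trans (Nat.le_succ i))]
      rwa [List.take_of_length_le hge] at ih

end Multigraph

open Multigraph in
/-- Any two closures of an ordered tree `T` under a partial `k`-edge-coloring `φ`
have the same vertex set: `V(cl_φ(T))` is uniquely determined by `T` and `φ`. -/
theorem closure_verts_unique {V E : Type} [Fintype V] [Fintype E]
    [DecidableEq V] [DecidableEq E] (G : Multigraph V E) {k : ℕ}
    (φ : G.PartialColoring k) (T L₁ L₂ : List E) (hT : G.IsOrderedTree T)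
    (h₁ : G.IsClosureOf φ T L₁) (h₂ : G.IsClosureOf φ T L₂) :
    G.treeVerts L₁ = G.treeVerts L₂ :=
  (h₁.treeVerts_subset hT.1 h₂).antisymm (h₂.treeVerts_subset hT.1 h₁)
end

section
/- Let (G,g,φ,α₀) be a quadruple and let T be a tree of G containing both ends of g. If T is both φ-elementary and φ-closed, then there exists a color α ∈ [k] such that at least two edges of ∂T are colored α by φ. -/
open scoped Classical

namespace Multigraph

variable {V E : Type} (G : Multigraph V E) {k : ℕ}

/-- In an elementary set, each color is missing at no more than one vertex. -/
lemma PartialColoring.card_filter_missing_le_one {G : Multigraph V E} (φ : G.PartialColoring k) {X : Finset V}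
    (hX : G.IsElemOn φ (X : Set V)) (c : ℕ) :
    (X.filter fun v => c ∈ φ.missing v).card ≤ 1 := by
  rw [Finset.card_le_one]
  intro u hu v hv
  simp only [Finset.mem_filter] at hu hv
  by_contra huv
  have hmem : c ∈ φ.missing u ∩ φ.missing v := ⟨hu.2, hv.2⟩
  rw [hX u hu.1 v hv.1 huv] at hmem
  exact hmem

variable [Fintype E]

/-- The edges with both ends in `X`. -/
noncomputable def innerEdges (X : Finset V) : Finset E :=
  Finset.univ.filter fun e => ∀ v ∈ G.ends e, v ∈ X

/-- The edges with exactly one end in `X`, as a finset. -/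
noncomputable def boundaryEdges (X : Finset V) : Finset E :=
  Finset.univ.filter fun e => e ∈ G.boundary (X : Set V)

/-- The number of ends of `e` in `X`: two, one or zero according to whether `e` is
an inner edge of `X`, a boundary edge of `X` or neither. -/
lemma card_filter_mem_ends [DecidableEq V] (X : Finset V) (e : E) :
    (X.filter fun v => v ∈ G.ends e).card =
      2 * (if e ∈ G.innerEdges X then 1 else 0) +
        (if e ∈ G.boundaryEdges X then 1 else 0) := by
  have hl := G.loopless e
  obtain ⟨⟨a, b⟩, hab⟩ := Quot.exists_rep (G.ends e)
  replace hab : G.ends e = s(a, b) := hab.symm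
  rw [hab, Sym2.mk_isDiag_iff] at hl
  have hX : (X.filter fun v => v ∈ G.ends e) = ({a, b} : Finset V).filter (· ∈ X) := by
    ext v
    simp only [hab, Finset.mem_filter, Sym2.mem_iff, Finset.mem_insert, Finset.mem_singleton]
    tauto
  have hinner : e ∈ G.innerEdges X ↔ a ∈ X ∧ b ∈ X := by
    simp [innerEdges, hab]
  have hbdry : e ∈ G.boundaryEdges X ↔ (a ∈ X ∧ b ∉ X) ∨ (b ∈ X ∧ a ∉ X) := by
    simp only [boundaryEdges, boundary, hab, Finset.mem_filter, Finset.mem_univ, true_and,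
      Set.mem_ofPred_eq, Finset.mem_coe]
    constructor
    · rintro ⟨u, w, h, hu, hw⟩
      rcases Sym2.eq_iff.1 h with ⟨rfl, rfl⟩ | ⟨rfl, rfl⟩ <;> tauto
    · rintro (h | h)
      · exact ⟨a, b, rfl, h⟩
      · exact ⟨b, a, Sym2.eq_swap, h⟩
  rw [hX]
  by_cases ha : a ∈ X <;> by_cases hb : b ∈ X <;>
    simp [Finset.filter_insert, Finset.filter_singleton, hinner, hbdry, ha, hb, hl]

variable {G}

namespace PartialColoring

/-- Double counting the ends in `X` of the edges colored `c`. -/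
lemma card_filter_seen (φ : G.PartialColoring k) (X : Finset V) (c : ℕ) :
    (X.filter fun v => ∃ e, v ∈ G.ends e ∧ φ.map e = some c).card =
      2 * ((G.innerEdges X).filter fun e => φ.map e = some c).card +
        ((G.boundaryEdges X).filter fun e => φ.map e = some c).card := by
  have hunion : (X.filter fun v => ∃ e, v ∈ G.ends e ∧ φ.map e = some c) =
      (Finset.univ.filter fun e => φ.map e = some c).biUnion
        fun e => X.filter fun v => v ∈ G.ends e := by
    ext v
    simp only [Finset.mem_filter, Finset.mem_biUnion, Finset.mem_univ, true_and]
    grind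
  have hI (S : Finset E) : (S.filter fun e => φ.map e = some c) =
      (Finset.univ.filter fun e => φ.map e = some c).filter (· ∈ S) := by
    ext e
    simp [and_comm]
  rw [hunion, Finset.card_biUnion]
  · simp_rw [card_filter_mem_ends]
    rw [Finset.sum_add_distrib, ← Finset.mul_sum, hI (G.innerEdges X), hI (G.boundaryEdges X),
      Finset.card_filter, Finset.card_filter]
  · intro e he f hf hef
    refine Finset.disjoint_left.2 ?_
    intro v hve hvf
    simp only [Finset.mem_filter, Finset.mem_univ, true_and, Finset.coe_filter, Set.mem_ofPred_eq] at he hf hve hvf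
    exact φ.proper e f c hef ⟨v, hve.2, hvf.2⟩ he hf

lemma card_filter_missing_add_card_filter_seen (φ : G.PartialColoring k) (X : Finset V)
    {c : ℕ} (hc : c ∈ Finset.Icc 1 k) :
    (X.filter fun v => c ∈ φ.missing v).card +
      (X.filter fun v => ∃ e, v ∈ G.ends e ∧ φ.map e = some c).card = X.card := by
  rw [← Finset.card_filter_add_card_filter_not (s := X) (fun v => c ∈ φ.missing v)]
  congr 2
  ext v
  simp [missing, Finset.mem_Icc.1 hc]

/-- The edges inside `X` carrying the colors of `[k]`, counted color by color. -/
lemma sum_card_filter_inner_le (φ : G.PartialColoring k) (X : Finset V) {g : E}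
    (hg : g ∈ G.innerEdges X) (hφg : φ.map g = none) :
    ∑ c ∈ Finset.Icc 1 k, ((G.innerEdges X).filter fun e => φ.map e = some c).card + 1 ≤
      (G.innerEdges X).card := by
  rw [← Finset.card_biUnion, Nat.add_one_le_iff]
  · refine Finset.card_lt_card ((Finset.ssubset_iff_of_subset ?_).2 ⟨g, hg, ?_⟩)
    · exact Finset.biUnion_subset.2 fun c _ => Finset.filter_subset _ _
    · simp [hφg]
  · intro c _ d _ hcd
    refine Finset.disjoint_left.2 ?_
    intro e hc hd
    simp only [Finset.mem_filter] at hc hd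
    exact hcd (Option.some.inj (hc.2.symm.trans hd.2))

end PartialColoring

variable (G)

/-- The density bound behind `Γ(G)`, without division. -/
lemma two_mul_card_innerEdges_le [Fintype V] (X : Finset V) (hodd : Odd X.card) (hX : 3 ≤ X.card) :
    2 * (G.innerEdges X).card ≤ G.gamma * (X.card - 1) := by
  have hsub : G.IsSub (X, G.innerEdges X) := by
    intro e he v hv
    simp only [innerEdges, Finset.mem_filter, Finset.mem_univ, true_and] at he
    exact he v hv
  have hle : ⌈(2 * ((G.innerEdges X).card : ℚ)) / ((X.card : ℚ) - 1)⌉₊ ≤ G.gamma := by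
    have h := Finset.le_sup (f := fun p : Finset V × Finset E =>
      if G.IsSub p ∧ Odd p.1.card ∧ 3 ≤ p.1.card then
        ⌈(2 * (p.2.card : ℚ)) / ((p.1.card : ℚ) - 1)⌉₊
      else 0) (Finset.mem_univ (X, G.innerEdges X))
    simp only [hsub, hodd, hX, and_self, if_true] at h
    exact h
  have hX' : (3 : ℚ) ≤ X.card := by exact_mod_cast hX
  rw [Nat.ceil_le, div_le_iff₀ (by linarith)] at hle
  have hcast : ((X.card - 1 : ℕ) : ℚ) = (X.card : ℚ) - 1 := by
    rw [Nat.cast_sub (by omega), Nat.cast_one]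
  rw [← hcast] at hle
  exact_mod_cast hle

end Multigraph

open Multigraph in
/-- Let `(G,g,φ,α₀)` be a quadruple and `T` a tree of `G` containing both ends
of `g`. If `T` is both `φ`-elementary and `φ`-closed, then some color `α ∈ [k]`
appears on at least two edges of `∂T`. -/
theorem exists_repeated_boundary_color {V E : Type} [Fintype V] [Fintype E]
    [DecidableEq V] [DecidableEq E] (G : Multigraph V E) (Q : Multigraph.Quadruple G)
    (T : List E) (hT : G.IsOrderedTree T)
    (hg : ∀ v ∈ G.ends Q.g, v ∈ G.treeVerts T)
    (helem : G.IsElemTree Q.φ T) (hclosed : G.IsClosedTree Q.φ T) :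
    ∃ α ∈ Finset.Icc 1 G.goldbergBound, ∃ e₁ e₂ : E, e₁ ≠ e₂ ∧
      e₁ ∈ G.boundary (G.treeVerts T) ∧ e₂ ∈ G.boundary (G.treeVerts T) ∧
      Q.φ.map e₁ = some α ∧ Q.φ.map e₂ = some α := by
  set X : Finset V := Finset.univ.filter (· ∈ G.treeVerts T) with hXdef
  have hX : (X : Set V) = G.treeVerts T := by ext v; simp [hXdef]
  rw [IsElemTree, ← hX] at helem
  rw [IsClosedTree, ← hX] at hclosed
  rw [← hX] at hg ⊢
  have hginner : Q.g ∈ G.innerEdges X := by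
    simpa [innerEdges] using hg
  have hbdry (c : ℕ) : ((G.boundaryEdges X).filter fun e => Q.φ.map e = some c) =
      Finset.univ.filter fun e => e ∈ G.boundary (X : Set V) ∧ Q.φ.map e = some c := by
    ext e
    simp [boundaryEdges]
  have hodd : Odd X.card := by
    obtain ⟨v, hv, hα⟩ := Set.mem_iUnion₂.1 Q.α₀_missing
    have hvX : v ∈ X := hg v hv
    have hαk : Q.α₀ ∈ Finset.Icc 1 G.goldbergBound := hα.1
    have hmiss : 0 < (X.filter fun v => Q.α₀ ∈ Q.φ.missing v).card :=
      Finset.card_pos.2 ⟨v, Finset.mem_filter.2 ⟨hvX, hα⟩⟩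
    have hzero : ((G.boundaryEdges X).filter fun e => Q.φ.map e = some Q.α₀).card = 0 := by
      rw [hbdry, Finset.card_eq_zero, Finset.filter_eq_empty_iff]
      rintro e - ⟨he, hc⟩
      exact hclosed e he _ hc (Set.mem_iUnion₂.2 ⟨v, hvX, hα⟩)
    have hone := Q.φ.card_filter_missing_le_one helem Q.α₀
    have hsplit := Q.φ.card_filter_missing_add_card_filter_seen X hαk
    rw [Q.φ.card_filter_seen] at hsplit
    exact ⟨((G.innerEdges X).filter fun e => Q.φ.map e = some Q.α₀).card, by omega⟩
  have hthree : 3 ≤ X.card := by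
    have htwo := Finset.card_filter_le X fun v => v ∈ G.ends Q.g
    rw [card_filter_mem_ends, if_pos hginner] at htwo
    obtain ⟨m, hm⟩ := hodd
    omega
  by_contra hno
  have hcolor : ∀ c ∈ Finset.Icc 1 G.goldbergBound,
      X.card - 1 ≤ 2 * ((G.innerEdges X).filter fun e => Q.φ.map e = some c).card := by
    intro c hc
    have hone := Q.φ.card_filter_missing_le_one helem c
    have hsplit := Q.φ.card_filter_missing_add_card_filter_seen X hc
    rw [Q.φ.card_filter_seen] at hsplit
    have hB : ((G.boundaryEdges X).filter fun e => Q.φ.map e = some c).card ≤ 1 := by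
      rw [hbdry, Finset.card_le_one]
      intro e he f hf
      simp only [Finset.mem_filter, Finset.mem_univ, true_and] at he hf
      by_contra hef
      exact hno ⟨c, hc, e, f, hef, he.1, hf.1, he.2, hf.2⟩
    obtain ⟨m, hm⟩ := hodd
    omega
  have hsum := Finset.card_nsmul_le_sum _ _ _ hcolor
  rw [← Finset.mul_sum, Nat.card_Icc, Nat.add_sub_cancel, smul_eq_mul] at hsum
  have hinner := Q.φ.sum_card_filter_inner_le X hginner Q.g_uncolored
  have hgamma := G.two_mul_card_innerEdges_le X hodd hthree
  have hbound : G.gamma * (X.card - 1) ≤ G.goldbergBound * (X.card - 1) :=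
    Nat.mul_le_mul_right _ (le_max_right _ _)
  omega
end

section
/- Let G be a multigraph, g ∈ E(G), and φ a partial k-edge-coloring of G−g with k = max{Δ(G)+1, Γ(G)}. If cl_φ(G[g]) is not φ-elementary, then there is a partial k-edge-coloring π of G whose support is φ⁻¹([k]) ∪ {g} (i.e., π colors g and all edges colored by φ) such that the restriction of π to G−g is Kempe equivalent to φ. -/
open scoped Classical

namespace SimpleGraph

/-- In a graph of maximum degree at most two, a component contains at most two vertices of
degree at most one. -/
theorem not_reachable_third_end {V : Type} (H : SimpleGraph V)
    (hdeg : ∀ x a b c, H.Adj x a → H.Adj x b → H.Adj x c → a = b ∨ a = c ∨ b = c)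
    {u v w : V} (huv : u ≠ v) (huw : u ≠ w) (hvw : v ≠ w)
    (hu : ∀ a b, H.Adj u a → H.Adj u b → a = b) (hv : ∀ a b, H.Adj v a → H.Adj v b → a = b)
    (hw : ∀ a b, H.Adj w a → H.Adj w b → a = b) (h : H.Reachable u v) :
    ¬ H.Reachable u w := by
  obtain ⟨p, hp⟩ := h.exists_isPath
  have hpos : 0 < p.length := by
    rcases Nat.eq_zero_or_pos p.length with h0 | h0
    · exact absurd (Walk.eq_of_length_eq_zero h0) huv
    · exact h0
  have hprev : ∀ i, 0 < i → i ≤ p.length → H.Adj (p.getVert i) (p.getVert (i - 1)) := by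
    intro i hi hl
    have := p.adj_getVert_succ (i := i - 1) (by omega)
    rw [Nat.sub_add_cancel hi] at this
    exact this.symm
  have hne : ∀ i, 0 < i → i < p.length → p.getVert (i - 1) ≠ p.getVert (i + 1) := by
    intro i hi hl he
    have := hp.getVert_injOn (x₁ := i - 1) (x₂ := i + 1) (by simp; omega) (by simp; omega) he
    omega
  have hclosed : ∀ i ≤ p.length, ∀ b, H.Adj (p.getVert i) b →
      ∃ j ≤ p.length, p.getVert j = b := by
    intro i hi b hb
    rcases Nat.eq_zero_or_pos i with h0 | h0
    · subst h0
      refine ⟨1, hpos, ?_⟩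
      have h1 := p.adj_getVert_succ hpos
      rw [p.getVert_zero] at h1 hb
      exact hu _ _ h1 hb
    · rcases Nat.lt_or_ge i p.length with hl | hl
      · have h1 := p.adj_getVert_succ hl
        have h2 := hprev i h0 hi
        rcases hdeg _ _ _ _ h2 h1 hb with h3 | h3 | h3
        · exact absurd h3 (hne i h0 hl)
        · exact ⟨i - 1, by omega, h3⟩
        · exact ⟨i + 1, by omega, h3⟩
      · obtain rfl : i = p.length := le_antisymm hi hl
        have h2 := hprev _ h0 le_rfl
        refine ⟨p.length - 1, by omega, ?_⟩
        rw [p.getVert_length] at h2 hb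
        exact hv _ _ h2 hb
  intro hr
  have hall : ∃ j ≤ p.length, p.getVert j = w := by
    obtain ⟨q⟩ := hr
    have : ∀ {a b : V} (q : H.Walk a b), (∃ j ≤ p.length, p.getVert j = a) →
        ∃ j ≤ p.length, p.getVert j = b := by
      intro a b q
      induction q with
      | nil => exact id
      | cons hadj _ ih =>
        rintro ⟨j, hj, rfl⟩
        exact ih (hclosed j hj _ hadj)
    exact this q ⟨0, Nat.zero_le _, p.getVert_zero⟩
  obtain ⟨j, hj, rfl⟩ := hall
  have hj0 : 0 < j := by
    rcases Nat.eq_zero_or_pos j with h0 | h0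
    · subst h0; exact absurd p.getVert_zero.symm huw
    · exact h0
  have hjl : j < p.length := by
    rcases hj.lt_or_eq with h0 | h0
    · exact h0
    · subst h0; exact absurd p.getVert_length.symm hvw
  exact hne j hj0 hjl (hw _ _ (hprev j hj0 hj) (p.adj_getVert_succ hjl))

/-- A vertex `w ∉ X` reachable from `X` is joined to `X` by a path meeting `X` only in its
first vertex. -/
theorem exists_path_from_set {V : Type} (H : SimpleGraph V) (X : Set V) {x w : V}
    (hx : x ∈ X) (hw : w ∉ X) (h : H.Reachable x w) :
    ∃ (s : ℕ) (q : ℕ → V), 1 ≤ s ∧ q 0 ∈ X ∧ q s = w ∧ (∀ i < s, H.Adj (q i) (q (i + 1))) ∧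
      (∀ i, 1 ≤ i → i ≤ s → q i ∉ X) ∧ ∀ i ≤ s, ∀ j ≤ s, q i = q j → i = j := by
  have hex : ∃ s, ∃ z ∈ X, ∃ p : H.Walk z w, p.length = s :=
    let ⟨p⟩ := h
    ⟨_, x, hx, p, rfl⟩
  classical
  obtain ⟨z, hz, p, hp⟩ := Nat.find_spec hex
  have hmin : ∀ z' ∈ X, ∀ p' : H.Walk z' w, p.length ≤ p'.length := by
    intro z' hz' p'
    rw [hp]
    exact Nat.find_min' hex ⟨z', hz', p', rfl⟩
  have hpath : p.IsPath := by
    rw [← p.bypass_eq_self_of_length_le_length_bypass (hmin z hz p.bypass)]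
    exact p.bypass_isPath
  refine ⟨p.length, p.getVert, ?_, by simpa using hz, p.getVert_length,
    fun i hi => p.adj_getVert_succ hi, ?_, fun i hi j hj hij => hpath.getVert_injOn hi hj hij⟩
  · rcases Nat.eq_zero_or_pos p.length with h0 | h0
    · exact absurd (Walk.eq_of_length_eq_zero h0 ▸ hz) hw
    · exact h0
  · intro i hi hl hX
    have := hmin _ hX (p.drop i)
    rw [Walk.drop_length] at this
    omega

end SimpleGraph

namespace Multigraph

namespace PartialColoring

variable {V E : Type} {G : Multigraph V E} {k : ℕ}

theorem swapColor_eq_map (α β : ℕ) (o : Option ℕ) :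
    swapColor α β o = o.map (Equiv.swap α β) := by
  cases o with
  | none => simp [swapColor]
  | some c =>
    simp only [swapColor, Option.map_some, Equiv.swap_apply_def, Option.some.injEq]
    split_ifs <;> rfl

theorem swapColor_injective (α β : ℕ) : Function.Injective (swapColor α β) := by
  intro a b h
  rw [swapColor_eq_map, swapColor_eq_map] at h
  exact Option.map_injective (Equiv.swap α β).injective h

theorem swapColor_of_ne {α β : ℕ} {o : Option ℕ} (hα : o ≠ some α) (hβ : o ≠ some β) :
    swapColor α β o = o := by
  simp [swapColor, hα, hβ]

/-- The simple graph on `V` underlying the edges colored `α` or `β`. -/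
def chainGraph (φ : G.PartialColoring k) (α β : ℕ) : SimpleGraph V where
  Adj u v := u ≠ v ∧ ∃ e ∈ φ.twoColored α β, G.ends e = s(u, v)
  symm := ⟨fun u v ⟨h, e, he, hs⟩ => ⟨h.symm, e, he, by rw [hs, Sym2.eq_swap]⟩⟩
  loopless := ⟨fun _ h => h.1 rfl⟩

/-- The vertex set of the `(α, β)`-chain through `v`. -/
def chain (φ : G.PartialColoring k) (α β : ℕ) (v : V) : Set V :=
  {u | (φ.chainGraph α β).Reachable v u}

theorem mem_chain_self (φ : G.PartialColoring k) (α β : ℕ) (v : V) : v ∈ φ.chain α β v :=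
  SimpleGraph.Reachable.refl v

theorem chainGraph_adj_of_ends {φ : G.PartialColoring k} {α β : ℕ} {e : E} {u v : V}
    (he : e ∈ φ.twoColored α β) (h : G.ends e = s(u, v)) : (φ.chainGraph α β).Adj u v := by
  refine ⟨?_, e, he, h⟩
  rintro rfl
  exact G.loopless e (by rw [h]; exact Sym2.mk_isDiag_iff.mpr rfl)

theorem mem_chain_of_mem_ends {φ : G.PartialColoring k} {α β : ℕ} {v x y : V} {e : E}
    (he : e ∈ φ.twoColored α β) (hx : x ∈ G.ends e) (hy : y ∈ G.ends e)
    (h : x ∈ φ.chain α β v) : y ∈ φ.chain α β v := by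
  by_cases hxy : x = y
  · exact hxy ▸ h
  · have hs : G.ends e = s(x, y) := (Sym2.mem_and_mem_iff hxy).mp ⟨hx, hy⟩
    exact SimpleGraph.Reachable.trans h (chainGraph_adj_of_ends he hs).reachable

theorem eq_of_mem_ends {φ : G.PartialColoring k} {c : ℕ} {x : V} {e f : E}
    (he : φ.map e = some c) (hf : φ.map f = some c) (hxe : x ∈ G.ends e) (hxf : x ∈ G.ends f) :
    e = f := by
  by_contra h
  exact φ.proper e f c h ⟨x, hxe, hxf⟩ he hf

theorem chainGraph_adj_unique {φ : G.PartialColoring k} {α β : ℕ} {x : V}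
    (hx : α ∈ φ.missing x ∨ β ∈ φ.missing x) {a b : V} (ha : (φ.chainGraph α β).Adj x a)
    (hb : (φ.chainGraph α β).Adj x b) : a = b := by
  obtain ⟨_, e, he, hea⟩ := ha
  obtain ⟨_, f, hf, hfb⟩ := hb
  have hxe : x ∈ G.ends e := by rw [hea]; exact Sym2.mem_mk_left _ _
  have hxf : x ∈ G.ends f := by rw [hfb]; exact Sym2.mem_mk_left _ _
  have hef : e = f := by
    rcases hx with hx | hx
    · exact eq_of_mem_ends (he.resolve_left (hx.2 e hxe)) (hf.resolve_left (hx.2 f hxf)) hxe hxf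
    · exact eq_of_mem_ends (he.resolve_right (hx.2 e hxe)) (hf.resolve_right (hx.2 f hxf)) hxe hxf
  subst hef
  rw [hea] at hfb
  exact Sym2.congr_right.mp hfb

theorem chainGraph_adj_three {φ : G.PartialColoring k} {α β : ℕ} {x a b c : V}
    (ha : (φ.chainGraph α β).Adj x a) (hb : (φ.chainGraph α β).Adj x b)
    (hc : (φ.chainGraph α β).Adj x c) : a = b ∨ a = c ∨ b = c := by
  obtain ⟨_, e, he, hea⟩ := ha
  obtain ⟨_, f, hf, hfb⟩ := hb
  obtain ⟨_, h, hh, hhc⟩ := hc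
  have hxe : x ∈ G.ends e := by rw [hea]; exact Sym2.mem_mk_left _ _
  have hxf : x ∈ G.ends f := by rw [hfb]; exact Sym2.mem_mk_left _ _
  have hxh : x ∈ G.ends h := by rw [hhc]; exact Sym2.mem_mk_left _ _
  have key : ∀ {e f : E} {a b : V}, e = f → G.ends e = s(x, a) → G.ends f = s(x, b) → a = b := by
    rintro e f a b rfl h1 h2
    rw [h1] at h2
    exact Sym2.congr_right.mp h2
  rcases he with he | he <;> rcases hf with hf | hf <;> rcases hh with hh | hh
  · exact .inl (key (eq_of_mem_ends he hf hxe hxf) hea hfb)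
  · exact .inl (key (eq_of_mem_ends he hf hxe hxf) hea hfb)
  · exact .inr (.inl (key (eq_of_mem_ends he hh hxe hxh) hea hhc))
  · exact .inr (.inr (key (eq_of_mem_ends hf hh hxf hxh) hfb hhc))
  · exact .inr (.inr (key (eq_of_mem_ends hf hh hxf hxh) hfb hhc))
  · exact .inr (.inl (key (eq_of_mem_ends he hh hxe hxh) hea hhc))
  · exact .inl (key (eq_of_mem_ends he hf hxe hxf) hea hfb)
  · exact .inl (key (eq_of_mem_ends he hf hxe hxf) hea hfb)

/-- A chain has at most two vertices missing one of its colors. -/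
theorem notMem_chain_of_two_ends {φ : G.PartialColoring k} {α β : ℕ} {u v w : V}
    (huv : u ≠ v) (huw : u ≠ w) (hvw : v ≠ w) (hu : α ∈ φ.missing u ∨ β ∈ φ.missing u)
    (hv : α ∈ φ.missing v ∨ β ∈ φ.missing v) (hw : α ∈ φ.missing w ∨ β ∈ φ.missing w)
    (h : v ∈ φ.chain α β u) : w ∉ φ.chain α β u :=
  SimpleGraph.not_reachable_third_end _ (fun _ _ _ _ => chainGraph_adj_three) huv huw hvw
    (fun _ _ => chainGraph_adj_unique hu) (fun _ _ => chainGraph_adj_unique hv)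
    (fun _ _ => chainGraph_adj_unique hw) h

theorem mem_chain_comm {φ : G.PartialColoring k} {α β : ℕ} {u v : V} :
    u ∈ φ.chain α β v ↔ v ∈ φ.chain α β u :=
  SimpleGraph.reachable_comm

theorem mem_chain_trans {φ : G.PartialColoring k} {α β : ℕ} {u v w : V}
    (huv : v ∈ φ.chain α β u) (hvw : w ∈ φ.chain α β v) : w ∈ φ.chain α β u :=
  SimpleGraph.Reachable.trans huv hvw

/-- A set of vertices closed under adjacency contains every chain starting in it. -/
theorem chain_subset_of_closed {φ : G.PartialColoring k} {α β : ℕ} {v : V} {S : Set V}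
    (hv : v ∈ S) (hS : ∀ x ∈ S, ∀ y, (φ.chainGraph α β).Adj x y → y ∈ S) :
    φ.chain α β v ⊆ S := by
  rintro u ⟨p⟩
  induction p with
  | nil => exact hv
  | cons h _ ih => exact ih (hS _ hv _ h)

open scoped Classical in
/-- The map obtained by swapping `α` and `β` on the `(α, β)`-chain through `v`. -/
noncomputable def chainSwapMap (φ : G.PartialColoring k) (α β : ℕ) (v : V) : E → Option ℕ :=
  fun e => if ∃ x ∈ G.ends e, x ∈ φ.chain α β v then swapColor α β (φ.map e) else φ.map e

theorem chainSwapMap_of_mem {φ : G.PartialColoring k} {α β : ℕ} {v x : V} {e : E}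
    (hx : x ∈ G.ends e) (h : x ∈ φ.chain α β v) :
    φ.chainSwapMap α β v e = swapColor α β (φ.map e) :=
  if_pos ⟨x, hx, h⟩

theorem chainSwapMap_of_notMem {φ : G.PartialColoring k} {α β : ℕ} {v x : V} {e : E}
    (hx : x ∈ G.ends e) (h : x ∉ φ.chain α β v) : φ.chainSwapMap α β v e = φ.map e := by
  unfold chainSwapMap
  split_ifs with hy
  · obtain ⟨y, hy, hyc⟩ := hy
    refine swapColor_of_ne (fun he => h ?_) (fun he => h ?_)
    · exact mem_chain_of_mem_ends (.inl he) hy hx hyc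
    · exact mem_chain_of_mem_ends (.inr he) hy hx hyc
  · rfl

/-- The coloring `φ / P` where `P` is the `(α, β)`-chain through `v`. -/
noncomputable def chainSwap (φ : G.PartialColoring k) {α β : ℕ} (hα : α ∈ Finset.Icc 1 k)
    (hβ : β ∈ Finset.Icc 1 k) (v : V) : G.PartialColoring k where
  map := φ.chainSwapMap α β v
  mem_Icc := by
    intro e c h
    unfold chainSwapMap at h
    split_ifs at h
    · unfold swapColor at h
      split_ifs at h
      · exact Option.some.inj h ▸ hβ
      · exact Option.some.inj h ▸ hα
      · exact φ.mem_Icc e c h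
    · exact φ.mem_Icc e c h
  proper := by
    rintro e f c hef ⟨x, hxe, hxf⟩ he hf
    by_cases hx : x ∈ φ.chain α β v
    · rw [chainSwapMap_of_mem hxe hx] at he
      rw [chainSwapMap_of_mem hxf hx, ← he] at hf
      have hm := swapColor_injective α β hf
      cases hme : φ.map e with
      | none => rw [hme] at he; simp [swapColor] at he
      | some d => exact φ.proper e f d hef ⟨x, hxe, hxf⟩ hme (hm.trans hme)
    · rw [chainSwapMap_of_notMem hxe hx] at he
      rw [chainSwapMap_of_notMem hxf hx] at hf
      exact φ.proper e f c hef ⟨x, hxe, hxf⟩ he hf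

section chainSwap

variable {φ : G.PartialColoring k} {α β : ℕ} {hα : α ∈ Finset.Icc 1 k} {hβ : β ∈ Finset.Icc 1 k}
  {v : V}

theorem chainSwap_map_of_mem {x : V} {e : E} (hx : x ∈ G.ends e) (h : x ∈ φ.chain α β v) :
    (φ.chainSwap hα hβ v).map e = swapColor α β (φ.map e) :=
  chainSwapMap_of_mem hx h

theorem chainSwap_map_of_notMem {x : V} {e : E} (hx : x ∈ G.ends e) (h : x ∉ φ.chain α β v) :
    (φ.chainSwap hα hβ v).map e = φ.map e :=
  chainSwapMap_of_notMem hx h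

theorem chainSwap_map_of_ne {e : E} (h1 : φ.map e ≠ some α) (h2 : φ.map e ≠ some β) :
    (φ.chainSwap hα hβ v).map e = φ.map e := by
  change φ.chainSwapMap α β v e = φ.map e
  unfold chainSwapMap
  rw [swapColor_of_ne h1 h2, ite_self]

theorem chainSwap_map_mem_twoColored {e : E} (h : e ∈ φ.twoColored α β) :
    e ∈ (φ.chainSwap hα hβ v).twoColored α β := by
  change φ.chainSwapMap α β v e = some α ∨ φ.chainSwapMap α β v e = some β
  unfold chainSwapMap
  rcases h with h | h <;> rw [h] <;> unfold swapColor <;> split_ifs <;> simp_all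

theorem mem_missing_chainSwap_of_notMem {x : V} (h : x ∉ φ.chain α β v) {c : ℕ} :
    c ∈ (φ.chainSwap hα hβ v).missing x ↔ c ∈ φ.missing x := by
  refine and_congr_right fun _ => forall₂_congr fun e he => ?_
  rw [chainSwap_map_of_notMem he h]

theorem mem_missing_chainSwap_of_ne {x : V} {c : ℕ} (h1 : c ≠ α) (h2 : c ≠ β) :
    c ∈ (φ.chainSwap hα hβ v).missing x ↔ c ∈ φ.missing x := by
  by_cases h : x ∈ φ.chain α β v
  · refine and_congr_right fun _ => forall₂_congr fun e he => ?_
    rw [chainSwap_map_of_mem he h, ← (swapColor_injective α β).ne_iff (x := φ.map e),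
      swapColor_of_ne (o := some c) (by simpa using h1) (by simpa using h2)]
  · exact mem_missing_chainSwap_of_notMem h

theorem left_mem_missing_chainSwap {x : V} (h : x ∈ φ.chain α β v) (hm : β ∈ φ.missing x) :
    α ∈ (φ.chainSwap hα hβ v).missing x := by
  refine ⟨hα, fun e he hc => hm.2 e he ?_⟩
  rw [chainSwap_map_of_mem he h] at hc
  refine swapColor_injective α β (hc.trans ?_)
  unfold swapColor
  split_ifs <;> simp_all

theorem right_mem_missing_chainSwap {x : V} (h : x ∈ φ.chain α β v) (hm : α ∈ φ.missing x) :
    β ∈ (φ.chainSwap hα hβ v).missing x := by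
  refine ⟨hβ, fun e he hc => hm.2 e he ?_⟩
  rw [chainSwap_map_of_mem he h] at hc
  refine swapColor_injective α β (hc.trans ?_)
  simp [swapColor]

end chainSwap

theorem exists_mem_ends (e : E) : ∃ x, x ∈ G.ends e := by
  induction h : G.ends e with
  | _ a b => exact ⟨a, Sym2.mem_mk_left a b⟩

theorem mem_component_iff {φ : G.PartialColoring k} {α β : ℕ} {v : V} {e₀ e : E}
    (he₀ : e₀ ∈ φ.twoColored α β) (hv : v ∈ G.ends e₀) (he : e ∈ φ.twoColored α β) :
    e ∈ G.component φ α β e₀ ↔ ∃ x ∈ G.ends e, x ∈ φ.chain α β v := by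
  constructor
  · rintro ⟨-, h⟩
    have : ∀ x ∈ G.ends e, x ∈ φ.chain α β v := by
      clear he
      induction h with
      | refl => exact fun x hx => mem_chain_of_mem_ends he₀ hv hx (mem_chain_self φ α β v)
      | tail _ hadj ih =>
        obtain ⟨hb, hc, y, hyb, hyc⟩ := hadj
        exact fun x hx => mem_chain_of_mem_ends hc hyc hx (ih y hyb)
    obtain ⟨x, hx⟩ := exists_mem_ends (G := G) e
    exact ⟨x, hx, this x hx⟩
  · rintro ⟨x, hx, hc⟩
    refine ⟨he, ?_⟩
    have hsub : φ.chain α β v ⊆ {u | ∀ f ∈ φ.twoColored α β, u ∈ G.ends f →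
        Relation.ReflTransGen (G.compAdj φ α β) e₀ f} := by
      refine chain_subset_of_closed ?_ ?_
      · exact fun f hf hvf => .single ⟨he₀, hf, v, hv, hvf⟩
      · rintro a ha b ⟨_, f, hf, hfs⟩ f' hf' hb
        have haf : a ∈ G.ends f := by rw [hfs]; exact Sym2.mem_mk_left _ _
        have hbf : b ∈ G.ends f := by rw [hfs]; exact Sym2.mem_mk_right _ _
        exact (ha f hf haf).tail ⟨hf, hf', b, hbf, hb⟩
    exact hsub hc e he hx

theorem ext_map {φ ψ : G.PartialColoring k} (h : φ.map = ψ.map) : φ = ψ := by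
  cases φ; cases ψ; cases h; rfl

theorem kempeEquiv_chainSwap (φ : G.PartialColoring k) {α β : ℕ} (hα : α ∈ Finset.Icc 1 k)
    (hβ : β ∈ Finset.Icc 1 k) (v : V) : G.KempeEquiv φ (φ.chainSwap hα hβ v) := by
  by_cases h : ∃ e₀ ∈ φ.twoColored α β, v ∈ G.ends e₀
  · obtain ⟨e₀, he₀, hv⟩ := h
    refine .single ⟨α, β, e₀, hα, hβ, he₀, funext fun e => ?_⟩
    by_cases he : e ∈ φ.twoColored α β
    · change φ.chainSwapMap α β v e = _
      unfold chainSwapMap swapMap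
      simp only [mem_component_iff he₀ hv he]
    · rw [chainSwap_map_of_ne (fun h => he (.inl h)) (fun h => he (.inr h)), swapMap,
        if_neg fun hc => he hc.1]
  · have hsub : φ.chain α β v ⊆ {v} := by
      refine chain_subset_of_closed rfl ?_
      rintro _ rfl b ⟨_, f, hf, hfs⟩
      exact absurd ⟨f, hf, by rw [hfs]; exact Sym2.mem_mk_left _ _⟩ h
    have : φ.chainSwap hα hβ v = φ := by
      refine ext_map (funext fun e => ?_)
      by_cases he : ∃ x ∈ G.ends e, x ∈ φ.chain α β v
      · obtain ⟨x, hx, hxc⟩ := he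
        obtain rfl : x = v := hsub hxc
        exact chainSwap_map_of_ne (fun hc => h ⟨e, .inl hc, hx⟩) (fun hc => h ⟨e, .inr hc, hx⟩)
      · exact if_neg he
    rw [this]
    exact .refl

theorem kempeEquiv_map_eq_none {φ ψ : G.PartialColoring k} (h : G.KempeEquiv φ ψ) (e : E) :
    ψ.map e = none ↔ φ.map e = none := by
  induction h with
  | refl => rfl
  | tail _ hs ih =>
    obtain ⟨α, β, e₀, -, -, -, hm⟩ := hs
    rw [← ih, hm]
    unfold swapMap
    split_ifs
    · rw [swapColor_eq_map, Option.map_eq_none_iff]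
    · rfl

/-- At least `k - d(v)` colors are missing at `v`, where `d(v)` counts colored edges. -/
theorem le_ncard_missing [Fintype E] {φ : G.PartialColoring k} {v : V} {F : Finset E}
    (hF : ∀ e, v ∈ G.ends e → φ.map e ≠ none → e ∈ F) : k ≤ (φ.missing v).ncard + F.card := by
  classical
  have hcov : Finset.Icc 1 k ⊆ (Finset.Icc 1 k).filter (· ∈ φ.missing v) ∪
      F.image fun e => (φ.map e).getD 0 := by
    intro c hc
    by_cases hm : c ∈ φ.missing v
    · exact Finset.mem_union_left _ (Finset.mem_filter.mpr ⟨hc, hm⟩)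
    · have : ∃ e, v ∈ G.ends e ∧ φ.map e = some c := by
        by_contra hcon
        exact hm ⟨hc, fun e he heq => hcon ⟨e, he, heq⟩⟩
      obtain ⟨e, he, heq⟩ := this
      exact Finset.mem_union_right _ (Finset.mem_image.mpr
        ⟨e, hF e he (by simp [heq]), by simp [heq]⟩)
  have h1 := (Finset.card_le_card hcov).trans (Finset.card_union_le _ _)
  have h2 : φ.missing v = ((Finset.Icc 1 k).filter (· ∈ φ.missing v) : Finset ℕ) := by
    ext c
    simp only [Finset.coe_filter, Set.mem_ofPred_eq]
    exact ⟨fun h => ⟨h.1, h⟩, fun h => h.2⟩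
  have h3 : (F.image fun e => (φ.map e).getD 0).card ≤ F.card := Finset.card_image_le
  rw [h2, Set.ncard_coe_finset]
  rw [Nat.card_Icc] at h1
  omega

theorem finite_missing (φ : G.PartialColoring k) (v : V) : (φ.missing v).Finite :=
  (Finset.finite_toSet (Finset.Icc 1 k)).subset fun _ h => h.1

end PartialColoring

end Multigraph

namespace Multigraph

open PartialColoring

variable {V E : Type} {G : Multigraph V E} {k : ℕ}

/-- `(y 0, e 1, y 1, …, e n, y n)` is a Tashkinov tree starting with the uncolored edge `g`:
each `e m` joins `y m` to an earlier vertex and, for `m ≥ 2`, its color is missing at an earlier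
vertex. -/
structure IsTashkinovSeq (φ : G.PartialColoring k) (g : E) (y : ℕ → V) (e : ℕ → E) (n : ℕ) :
    Prop where
  one_le : 1 ≤ n
  first : e 1 = g
  inj : ∀ i ≤ n, ∀ j ≤ n, y i = y j → i = j
  attach : ∀ m, 1 ≤ m → m ≤ n → ∃ j < m, G.ends (e m) = s(y j, y m)
  color : ∀ m, 2 ≤ m → m ≤ n → ∃ c, φ.map (e m) = some c ∧ ∃ j < m, c ∈ φ.missing (y j)

/-- The vertices `y 0, …, y n` have pairwise disjoint sets of missing colors. -/
def IsElemSeq (φ : G.PartialColoring k) (y : ℕ → V) (n : ℕ) : Prop :=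
  ∀ i j, i < j → j ≤ n → ∀ c ∈ φ.missing (y i), c ∉ φ.missing (y j)

/-- `(y p, e (p + 1), …, e n, y n)` is a path. -/
def IsPathFrom (G : Multigraph V E) (y : ℕ → V) (e : ℕ → E) (p n : ℕ) : Prop :=
  ∀ m, p < m → m ≤ n → G.ends (e m) = s(y (m - 1), y m)

/-- No edge among `e 2, …, e r` has color `c`. -/
def IsUnused (φ : G.PartialColoring k) (e : ℕ → E) (r c : ℕ) : Prop :=
  ∀ m, 2 ≤ m → m ≤ r → φ.map (e m) ≠ some c

/-- A family of colorings that is closed under chain swaps, and in which the uncolored edge `g`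
never has a color missing at both of its ends. -/
structure IsStuckFamily (𝒦 : Set (G.PartialColoring k)) (g : E) : Prop where
  swap : ∀ φ ∈ 𝒦, ∀ α β (hα : α ∈ Finset.Icc 1 k) (hβ : β ∈ Finset.Icc 1 k) v,
    φ.chainSwap hα hβ v ∈ 𝒦
  uncolored : ∀ φ ∈ 𝒦, φ.map g = none
  disjoint : ∀ φ ∈ 𝒦, ∀ a b, G.ends g = s(a, b) → ∀ c ∈ φ.missing a, c ∉ φ.missing b

section

variable {φ : G.PartialColoring k} {𝒦 : Set (G.PartialColoring k)} {g : E} {y : ℕ → V}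
  {e : ℕ → E} {n r : ℕ}

theorem IsTashkinovSeq.take (h : IsTashkinovSeq φ g y e n) {m : ℕ} (hm : 1 ≤ m) (hmn : m ≤ n) :
    IsTashkinovSeq φ g y e m where
  one_le := hm
  first := h.first
  inj i hi j hj := h.inj i (hi.trans hmn) j (hj.trans hmn)
  attach l h1 h2 := h.attach l h1 (h2.trans hmn)
  color l h1 h2 := h.color l h1 (h2.trans hmn)

theorem IsUnused.mono {c : ℕ} (h : IsUnused φ e n c) {m : ℕ} (hm : m ≤ n) : IsUnused φ e m c :=
  fun l h1 h2 => h l h1 (h2.trans hm)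

theorem IsUnused.succ {c : ℕ} (h : IsUnused φ e n c) (hc : φ.map (e (n + 1)) ≠ some c) :
    IsUnused φ e (n + 1) c := by
  intro l h1 h2
  rcases Nat.lt_or_ge n l with hl | hl
  · obtain rfl : l = n + 1 := by omega
    exact hc
  · exact h l h1 hl

theorem IsElemSeq.mono (h : IsElemSeq φ y n) {m : ℕ} (hm : m ≤ n) : IsElemSeq φ y m :=
  fun i j hij hj => h i j hij (hj.trans hm)

/-- A color missing at `y i` is not used up to `y i`. -/
theorem IsTashkinovSeq.isUnused (h : IsTashkinovSeq φ g y e n) {i c : ℕ} (hi : i ≤ n)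
    (hel : IsElemSeq φ y i) (hc : c ∈ φ.missing (y i)) : IsUnused φ e i c := by
  intro m h2 hm heq
  obtain ⟨d, hd, j, hj, hdj⟩ := h.color m h2 (hm.trans hi)
  obtain rfl : d = c := by rw [hd] at heq; exact Option.some.inj heq
  exact hel j i (by omega) le_rfl d hdj hc

theorem IsTashkinovSeq.left_mem (h : IsTashkinovSeq φ g y e n) {m : ℕ} (h1 : 1 ≤ m)
    (hm : m ≤ n) : ∃ j < m, y j ∈ G.ends (e m) := by
  obtain ⟨j, hj, hs⟩ := h.attach m h1 hm
  exact ⟨j, hj, by rw [hs]; exact Sym2.mem_mk_left _ _⟩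

theorem IsTashkinovSeq.right_mem (h : IsTashkinovSeq φ g y e n) {m : ℕ} (h1 : 1 ≤ m)
    (hm : m ≤ n) : y m ∈ G.ends (e m) := by
  obtain ⟨j, hj, hs⟩ := h.attach m h1 hm
  rw [hs]
  exact Sym2.mem_mk_right _ _

section swap

variable {α β : ℕ} {hα : α ∈ Finset.Icc 1 k} {hβ : β ∈ Finset.Icc 1 k} {v : V}

theorem IsUnused.chainSwap (h1 : IsUnused φ e r α) (h2 : IsUnused φ e r β) {c : ℕ}
    (hc : IsUnused φ e r c) : IsUnused (φ.chainSwap hα hβ v) e r c := by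
  intro m hm hr
  rw [chainSwap_map_of_ne (h1 m hm hr) (h2 m hm hr)]
  exact hc m hm hr

/-- A chain swap whose colors are unused up to `y r` preserves a Tashkinov tree, if both colors
are missing at vertices up to `y r` after the swap or the tree ends with `y r`. -/
theorem IsTashkinovSeq.chainSwap (h : IsTashkinovSeq φ g y e n)
    (h1 : IsUnused φ e r α) (h2 : IsUnused φ e r β)
    (h3 : r < n → ∃ i ≤ r, α ∈ (φ.chainSwap hα hβ v).missing (y i))
    (h4 : r < n → ∃ i ≤ r, β ∈ (φ.chainSwap hα hβ v).missing (y i)) :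
    IsTashkinovSeq (φ.chainSwap hα hβ v) g y e n where
  one_le := h.one_le
  first := h.first
  inj := h.inj
  attach := h.attach
  color := by
    intro m hm hmn
    obtain ⟨c, hc, j, hj, hcj⟩ := h.color m hm hmn
    by_cases hcc : c = α ∨ c = β
    · have hr : r < m := by
        by_contra hr
        rcases hcc with rfl | rfl
        · exact h1 m hm (by omega) hc
        · exact h2 m hm (by omega) hc
      have htwo : e m ∈ φ.twoColored α β := by
        rcases hcc with rfl | rfl
        · exact .inl hc
        · exact .inr hc
      rcases chainSwap_map_mem_twoColored (hα := hα) (hβ := hβ) (v := v) htwo with h5 | h5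
      · obtain ⟨i, hi, hm'⟩ := h3 (by omega)
        exact ⟨α, h5, i, by omega, hm'⟩
      · obtain ⟨i, hi, hm'⟩ := h4 (by omega)
        exact ⟨β, h5, i, by omega, hm'⟩
    · push Not at hcc
      refine ⟨c, ?_, j, hj, (mem_missing_chainSwap_of_ne hcc.1 hcc.2).mpr hcj⟩
      rw [chainSwap_map_of_ne, hc]
      · rw [hc]; simpa using hcc.1
      · rw [hc]; simpa using hcc.2

end swap

/-- If `α` is missing at `y i`, `β` is missing at `y j`, and `α` is unused up to `y j`, then
`y i` and `y j` are ends of the same `(α, β)`-chain. -/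
theorem mem_chain_of_isUnused (hK : IsStuckFamily 𝒦 g) {i j α β : ℕ} (hφ : φ ∈ 𝒦)
    (hT : IsTashkinovSeq φ g y e j)
    (hel : ∀ ψ ∈ 𝒦, IsTashkinovSeq ψ g y e j → IsElemSeq ψ y j) (hij : i < j)
    (hα : α ∈ φ.missing (y i)) (hβ : β ∈ φ.missing (y j)) (hu : IsUnused φ e j α) :
    y i ∈ φ.chain α β (y j) := by
  by_contra hc
  have h1 : IsTashkinovSeq (φ.chainSwap hα.1 hβ.1 (y j)) g y e j :=
    hT.chainSwap hu (hT.isUnused le_rfl (hel φ hφ hT) hβ) (fun h => absurd h (lt_irrefl _))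
      (fun h => absurd h (lt_irrefl _))
  exact hel _ (hK.swap φ hφ _ _ _ _ _) h1 i j hij le_rfl α
    ((mem_missing_chainSwap_of_notMem hc).mpr hα)
    (left_mem_missing_chainSwap (mem_chain_self _ _ _ _) hβ)

/-- If `y n` misses `α` and both `α` and `γ` are missing and unused up to `y r`, then the
`(α, γ)`-chain through `y n` avoids the vertices up to `y r` missing them. -/
theorem notMem_chain_last (hK : IsStuckFamily 𝒦 g) {i j α γ : ℕ}
    (hφ : φ ∈ 𝒦) (hT : IsTashkinovSeq φ g y e n)
    (hel : ∀ m < n, ∀ ψ ∈ 𝒦, IsTashkinovSeq ψ g y e m → IsElemSeq ψ y m)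
    (hi : i ≤ r) (hj : j ≤ r) (hr : r < n)
    (hαi : α ∈ φ.missing (y i)) (hγj : γ ∈ φ.missing (y j)) (hαn : α ∈ φ.missing (y n))
    (hα : IsUnused φ e r α) (hγ : IsUnused φ e r γ) :
    y i ∉ φ.chain α γ (y n) ∧ y j ∉ φ.chain α γ (y n) := by
  have hne : ∀ m < n, y m ≠ y n := fun m hm h =>
    absurd (hT.inj m hm.le n le_rfl h) hm.ne
  have key : i ≠ j → y i ∈ φ.chain α γ (y j) →
      y i ∉ φ.chain α γ (y n) ∧ y j ∉ φ.chain α γ (y n) := by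
    intro hij hc
    have hneij : y i ≠ y j := fun h => hij (hT.inj i (by omega) j (by omega) h)
    have h1 := notMem_chain_of_two_ends hneij.symm (hne j (by omega)) (hne i (by omega))
      (.inr hγj) (.inl hαi) (.inl hαn) hc
    exact ⟨fun h => h1 (mem_chain_trans hc (mem_chain_comm.mp h)),
      fun h => h1 (mem_chain_comm.mp h)⟩
  rcases lt_trichotomy i j with hij | rfl | hij
  · exact key hij.ne (mem_chain_of_isUnused hK hφ (hT.take (by omega) (by omega))
      (hel j (by omega)) hij hαi hγj (hα.mono hj))
  · have : y i ∉ φ.chain α γ (y n) := by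
      intro h
      have hsub : φ.chain α γ (y i) ⊆ {y i} := by
        refine chain_subset_of_closed rfl ?_
        rintro _ rfl b ⟨_, f, hf, hfs⟩
        have hmem : y i ∈ G.ends f := by rw [hfs]; exact Sym2.mem_mk_left _ _
        rcases hf with hf | hf
        · exact absurd hf (hαi.2 f hmem)
        · exact absurd hf (hγj.2 f hmem)
      exact hne i (by omega) (hsub (mem_chain_comm.mp h)).symm
    exact ⟨this, this⟩
  · have h := mem_chain_of_isUnused hK hφ (hT.take (by omega) (by omega))
      (hel i (by omega)) hij hγj hαi (hγ.mono hi)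
    have hsymm : φ.chainGraph γ α = φ.chainGraph α γ := by
      ext a b
      simp [chainGraph, twoColored, or_comm]
    refine key hij.ne' (mem_chain_comm.mp ?_)
    rw [chain, hsymm] at h
    exact h

/-- In the situation of `notMem_chain_last`, swapping the chain through `y n` keeps the tree and
makes `γ` missing at `y n`. -/
theorem isTashkinovSeq_swap_last (hK : IsStuckFamily 𝒦 g) {i j α γ : ℕ}
    (hφ : φ ∈ 𝒦) (hT : IsTashkinovSeq φ g y e n)
    (hel : ∀ m < n, ∀ ψ ∈ 𝒦, IsTashkinovSeq ψ g y e m → IsElemSeq ψ y m)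
    (hi : i ≤ r) (hj : j ≤ r) (hr : r < n)
    (hαi : α ∈ φ.missing (y i)) (hγj : γ ∈ φ.missing (y j)) (hαn : α ∈ φ.missing (y n))
    (hα : IsUnused φ e r α) (hγ : IsUnused φ e r γ) :
    IsTashkinovSeq (φ.chainSwap hαi.1 hγj.1 (y n)) g y e n ∧
      γ ∈ (φ.chainSwap hαi.1 hγj.1 (y n)).missing (y j) ∧
      γ ∈ (φ.chainSwap hαi.1 hγj.1 (y n)).missing (y n) := by
  obtain ⟨h1, h2⟩ := notMem_chain_last hK hφ hT hel hi hj hr hαi hγj hαn hα hγ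
  have h3 := (mem_missing_chainSwap_of_notMem (hα := hαi.1) (hβ := hγj.1) h2).mpr hγj
  exact ⟨hT.chainSwap hα hγ
    (fun _ => ⟨i, hi, (mem_missing_chainSwap_of_notMem h1).mpr hαi⟩)
    (fun _ => ⟨j, hj, h3⟩), h3, right_mem_missing_chainSwap (mem_chain_self _ _ _ _) hαn⟩

/-- A color shared by `y i` and `y n` and unused up to `y j` can be traded for a color shared by
`y j` and `y n`. -/
theorem exists_shared_of_isUnused (hK : IsStuckFamily 𝒦 g) {i j α : ℕ}
    (hφ : φ ∈ 𝒦) (hT : IsTashkinovSeq φ g y e n)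
    (hel : ∀ m < n, ∀ ψ ∈ 𝒦, IsTashkinovSeq ψ g y e m → IsElemSeq ψ y m)
    (hne : (φ.missing (y j)).Nonempty) (hij : i < j) (hjn : j < n)
    (hαi : α ∈ φ.missing (y i)) (hαn : α ∈ φ.missing (y n)) (hα : IsUnused φ e j α) :
    ∃ ψ ∈ 𝒦, IsTashkinovSeq ψ g y e n ∧ ∃ c ∈ ψ.missing (y j), c ∈ ψ.missing (y n) := by
  obtain ⟨γ, hγ⟩ := hne
  have hTj := hT.take (m := j) (by omega) hjn.le
  obtain ⟨h1, h2, h3⟩ := isTashkinovSeq_swap_last hK hφ hT hel hij.le le_rfl hjn hαi hγ hαn hα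
    (hTj.isUnused le_rfl (hel j hjn φ hφ hTj) hγ)
  exact ⟨_, hK.swap φ hφ _ _ _ _ _, h1, γ, h2, h3⟩

/-- Suppose that all Tashkinov trees that are paths from some `y q` with `q < p` on are
elementary. Then a two-colored chain through `y n` whose colors are missing up to `y r`, one of
them also at `y n`, avoids all vertices up to `y r`, provided that `r + 1 < p`. -/
theorem notMem_chain_of_lt {p i j α γ m : ℕ}
    (hφ : φ ∈ 𝒦) (hT : IsTashkinovSeq φ g y e n)
    (hlow : ∀ q < p, ∀ n' y' e', ∀ ψ ∈ 𝒦, IsTashkinovSeq ψ g y' e' n' →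
      IsPathFrom G y' e' q n' → IsElemSeq ψ y' n')
    (hr1 : 1 ≤ r) (hrp : r + 1 < p) (hr : r < n) (hi : i ≤ r) (hj : j ≤ r) (hm : m ≤ r)
    (hαi : α ∈ φ.missing (y i)) (hγj : γ ∈ φ.missing (y j)) (hαn : α ∈ φ.missing (y n)) :
    y m ∉ φ.chain α γ (y n) := by
  intro hc
  obtain ⟨s, q, hs, hq0, hqs, hadj, hqX, hinj⟩ :=
    SimpleGraph.exists_path_from_set (φ.chainGraph α γ) {x | ∃ l ≤ r, x = y l} ⟨m, hm, rfl⟩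
      (fun ⟨l, hl, h⟩ => by have := hT.inj n le_rfl l (by omega) h; omega)
      (mem_chain_comm.mp hc)
  obtain ⟨l, hl, hql⟩ := hq0
  have hedge : ∀ t, ∃ f, t < s → f ∈ φ.twoColored α γ ∧ G.ends f = s(q t, q (t + 1)) := by
    intro t
    by_cases ht : t < s
    · obtain ⟨-, f, hf, hfs⟩ := hadj t ht
      exact ⟨f, fun _ => ⟨hf, hfs⟩⟩
    · exact ⟨g, fun h => absurd h ht⟩
  choose f hf using hedge
  let y' : ℕ → V := fun t => if t ≤ r then y t else q (t - r)
  let e' : ℕ → E := fun t => if t ≤ r then e t else f (t - r - 1)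
  have hylow : ∀ t ≤ r, y' t = y t := fun t ht => if_pos ht
  have hyhigh : ∀ t, r < t → y' t = q (t - r) := fun t ht => if_neg (by omega)
  have helow : ∀ t ≤ r, e' t = e t := fun t ht => if_pos ht
  have hehigh : ∀ t, r < t → e' t = f (t - r - 1) := fun t ht => if_neg (by omega)
  have hends : ∀ t, r < t → t ≤ r + s → G.ends (e' t) = s(q (t - r - 1), q (t - r)) := by
    intro t h1 h2
    rw [hehigh t h1, (hf (t - r - 1) (by omega)).2, Nat.sub_add_cancel (by omega)]
  have hT' : IsTashkinovSeq φ g y' e' (r + s) := by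
    refine ⟨by omega, by rw [helow 1 hr1, hT.first], ?_, ?_, ?_⟩
    · intro a ha b hb hab
      rcases Nat.lt_or_ge r a with har | har <;> rcases Nat.lt_or_ge r b with hbr | hbr
      · rw [hyhigh a har, hyhigh b hbr] at hab
        have := hinj _ (by omega) _ (by omega) hab
        omega
      · rw [hyhigh a har, hylow b hbr] at hab
        exact absurd ⟨b, hbr, hab⟩ (hqX (a - r) (by omega) (by omega))
      · rw [hyhigh b hbr, hylow a har] at hab
        exact absurd ⟨a, har, hab.symm⟩ (hqX (b - r) (by omega) (by omega))
      · rw [hylow a har, hylow b hbr] at hab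
        exact hT.inj a (by omega) b (by omega) hab
    · intro t h1 ht
      rcases Nat.lt_or_ge r t with htr | htr
      · rw [hends t htr ht, hyhigh t htr]
        by_cases h0 : t = r + 1
        · refine ⟨l, by omega, ?_⟩
          rw [hylow l hl, ← hql, h0, Nat.add_sub_cancel_left, Nat.sub_self]
        · refine ⟨t - 1, by omega, ?_⟩
          rw [hyhigh _ (by omega), Nat.sub_right_comm]
      · obtain ⟨a, ha, hs'⟩ := hT.attach t h1 (by omega)
        exact ⟨a, ha, by rw [helow t htr, hylow a (by omega), hylow t htr, hs']⟩
    · intro t h1 ht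
      rcases Nat.lt_or_ge r t with htr | htr
      · rw [hehigh t htr]
        rcases (hf (t - r - 1) (by omega)).1 with h | h
        · exact ⟨α, h, i, by omega, by rw [hylow i hi]; exact hαi⟩
        · exact ⟨γ, h, j, by omega, by rw [hylow j hj]; exact hγj⟩
      · obtain ⟨c, hc, a, ha, hca⟩ := hT.color t h1 (by omega)
        exact ⟨c, by rw [helow t htr, hc], a, ha, by rw [hylow a (by omega)]; exact hca⟩
  have hpath : IsPathFrom G y' e' (r + 1) (r + s) := by
    intro t h1 h2
    rw [hends t (by omega) h2, hyhigh t (by omega), hyhigh (t - 1) (by omega), Nat.sub_right_comm]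
  refine hlow (r + 1) hrp _ _ _ φ hφ hT' hpath i (r + s) (by omega) le_rfl α ?_ ?_
  · rw [hylow i hi]; exact hαi
  · rw [hyhigh _ (by omega), Nat.add_sub_cancel_left, hqs]; exact hαn

end

end Multigraph

namespace Multigraph

open PartialColoring

variable {V E : Type} {G : Multigraph V E} {k : ℕ} {φ : G.PartialColoring k}
  {𝒦 : Set (G.PartialColoring k)} {g : E} {y : ℕ → V} {e : ℕ → E} {n : ℕ}

section counting

variable [Fintype E] [DecidableEq V]

theorem degree_lt_goldbergBound [Fintype V] [DecidableEq E] (v : V) : G.degree v < G.goldbergBound := by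
  have : G.degree v ≤ G.maxDegree := Finset.le_sup (f := G.degree) (Finset.mem_univ v)
  have h2 : G.maxDegree + 1 ≤ G.goldbergBound := le_max_left _ _
  omega

theorem one_le_ncard_missing (hk : ∀ v, G.degree v < k) (φ : G.PartialColoring k) (v : V) :
    1 ≤ (φ.missing v).ncard := by
  have h := le_ncard_missing (φ := φ) (v := v) (F := Finset.univ.filter fun e => v ∈ G.ends e)
    fun e he _ => Finset.mem_filter.mpr ⟨Finset.mem_univ e, he⟩
  have h2 : (Finset.univ.filter fun e => v ∈ G.ends e).card < k := hk v
  omega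

theorem missing_nonempty (hk : ∀ v, G.degree v < k) (φ : G.PartialColoring k) (v : V) :
    (φ.missing v).Nonempty :=
  Set.nonempty_of_ncard_ne_zero (by have := one_le_ncard_missing hk φ v; omega)

theorem two_le_ncard_missing (hk : ∀ v, G.degree v < k) {v : V} (hg : φ.map g = none)
    (hv : v ∈ G.ends g) : 2 ≤ (φ.missing v).ncard := by
  classical
  have hmem : g ∈ Finset.univ.filter fun e => v ∈ G.ends e :=
    Finset.mem_filter.mpr ⟨Finset.mem_univ g, hv⟩
  have h := le_ncard_missing (φ := φ) (v := v)
    (F := (Finset.univ.filter fun e => v ∈ G.ends e).erase g) fun e he hne =>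
      Finset.mem_erase.mpr ⟨fun h => hne (h ▸ hg), Finset.mem_filter.mpr ⟨Finset.mem_univ e, he⟩⟩
  have h2 : (Finset.univ.filter fun e => v ∈ G.ends e).card < k := hk v
  have h3 := Finset.card_pos.mpr ⟨g, hmem⟩
  rw [Finset.card_erase_of_mem hmem] at h
  omega

/-- An elementary Tashkinov tree on `y 0, …, y r` misses at least `r + 3` colors. -/
theorem exists_missing_notMem (hk : ∀ v, G.degree v < k) (hg : φ.map g = none)
    (hT : IsTashkinovSeq φ g y e n) {r : ℕ} (hr : 1 ≤ r) (hel : IsElemSeq φ y r)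
    (F : Finset ℕ) (hF : F.card ≤ r + 2) : ∃ γ ∉ F, ∃ j ≤ r, γ ∈ φ.missing (y j) := by
  classical
  have hsum : ∀ r, 1 ≤ r → r + 3 ≤ ∑ i ∈ Finset.range (r + 1), (φ.missing (y i)).ncard := by
    intro r hr
    induction r, hr using Nat.le_induction with
    | base =>
      have h1 := hT.right_mem le_rfl hT.one_le
      obtain ⟨j, hj, h0⟩ := hT.left_mem le_rfl hT.one_le
      obtain rfl : j = 0 := by omega
      rw [hT.first] at h0 h1
      have h2 := two_le_ncard_missing hk hg h0
      have h3 := two_le_ncard_missing hk hg h1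
      rw [Finset.sum_range_succ, Finset.sum_range_one]
      omega
    | succ r hr ih =>
      rw [Finset.sum_range_succ]
      have := one_le_ncard_missing hk φ (y (r + 1))
      omega
  let S := (Finset.range (r + 1)).biUnion fun i => (finite_missing φ (y i)).toFinset
  have hS : S.card = ∑ i ∈ Finset.range (r + 1), (φ.missing (y i)).ncard := by
    rw [Finset.card_biUnion]
    · exact Finset.sum_congr rfl fun i _ => (Set.ncard_eq_toFinset_card _ _).symm
    · intro i hi j hj hij
      rw [Function.onFun, Finset.disjoint_left]
      intro c hci hcj
      rw [Set.Finite.mem_toFinset] at hci hcj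
      simp only [Finset.coe_range, Set.mem_Iio] at hi hj
      rcases Nat.lt_or_gt_of_ne hij with h | h
      · exact hel i j h (by omega) c hci hcj
      · exact hel j i h (by omega) c hcj hci
  have hlt : F.card < S.card := by
    have := hsum r hr
    omega
  obtain ⟨γ, hγ, hγF⟩ := Finset.exists_mem_notMem_of_card_lt_card hlt
  obtain ⟨j, hj, hm⟩ := Finset.mem_biUnion.mp hγ
  rw [Finset.mem_range] at hj
  exact ⟨γ, hγF, j, by omega, (Set.Finite.mem_toFinset _).mp hm⟩

/-- There is a color missing up to `y r` and unused up to `y m`, avoiding a small set `F`. -/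
theorem exists_missing_isUnused (hk : ∀ v, G.degree v < k) (hg : φ.map g = none)
    (hT : IsTashkinovSeq φ g y e n) {r : ℕ} (hr : 1 ≤ r) (hel : IsElemSeq φ y r) (m : ℕ)
    (F : Finset ℕ) (hF : m - 1 + F.card ≤ r + 2) :
    ∃ γ ∉ F, (∃ j ≤ r, γ ∈ φ.missing (y j)) ∧ IsUnused φ e m γ := by
  classical
  let C := (Finset.Icc 2 m).image fun t => (φ.map (e t)).getD 0
  have hC : C.card ≤ m - 1 := Finset.card_image_le.trans (by rw [Nat.card_Icc]; omega)
  obtain ⟨γ, hγ, hj⟩ := exists_missing_notMem hk hg hT hr hel (C ∪ F)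
    ((Finset.card_union_le _ _).trans (by omega))
  rw [Finset.mem_union, not_or] at hγ
  refine ⟨γ, hγ.2, hj, fun t h1 h2 heq => hγ.1 ?_⟩
  exact Finset.mem_image.mpr ⟨t, Finset.mem_Icc.mpr ⟨h1, h2⟩, by simp [heq]⟩

end counting

/-- If `e n` joins `y n` to the tree up to `y (n - 2)` and its color is missing there, then
`y (n - 1)` can be left out. -/
theorem IsTashkinovSeq.skip (hT : IsTashkinovSeq φ g y e n) (hn : 3 ≤ n) {l j β : ℕ}
    (hl : l ≤ n - 2) (hends : G.ends (e n) = s(y l, y n)) (hβ : φ.map (e n) = some β)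
    (hj : j ≤ n - 2) (hβj : β ∈ φ.missing (y j)) :
    IsTashkinovSeq φ g (Function.update y (n - 1) (y n)) (Function.update e (n - 1) (e n))
      (n - 1) := by
  have hyl : ∀ t, t ≤ n - 2 → Function.update y (n - 1) (y n) t = y t :=
    fun t ht => Function.update_of_ne (by omega) _ _
  have hel : ∀ t, t ≤ n - 2 → Function.update e (n - 1) (e n) t = e t :=
    fun t ht => Function.update_of_ne (by omega) _ _
  refine ⟨by omega, by rw [hel 1 (by omega), hT.first], ?_, ?_, ?_⟩
  · intro a ha b hb hab
    rcases ha.lt_or_eq with ha' | rfl <;> rcases hb.lt_or_eq with hb' | rfl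
    · rw [hyl a (by omega), hyl b (by omega)] at hab
      exact hT.inj a (by omega) b (by omega) hab
    · rw [hyl a (by omega), Function.update_self] at hab
      have := hT.inj a (by omega) n le_rfl hab
      omega
    · rw [hyl b (by omega), Function.update_self] at hab
      have := hT.inj n le_rfl b (by omega) hab
      omega
    · rfl
  · intro t h1 ht
    rcases ht.lt_or_eq with ht' | rfl
    · obtain ⟨a, ha, hs⟩ := hT.attach t h1 (by omega)
      exact ⟨a, ha, by rw [hel t (by omega), hyl a (by omega), hyl t (by omega), hs]⟩
    · exact ⟨l, by omega, by rw [Function.update_self, Function.update_self, hyl l hl, hends]⟩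
  · intro t h1 ht
    rcases ht.lt_or_eq with ht' | rfl
    · obtain ⟨c, hc, a, ha, hca⟩ := hT.color t h1 (by omega)
      exact ⟨c, by rw [hel t (by omega), hc], a, ha, by rw [hyl a (by omega)]; exact hca⟩
    · exact ⟨β, by rw [Function.update_self, hβ], j, by omega, by rw [hyl j hj]; exact hβj⟩

/-- The roles of the two ends of `g` can be exchanged. -/
theorem IsTashkinovSeq.swap_first (hT : IsTashkinovSeq φ g y e n) :
    IsTashkinovSeq φ g (y ∘ Equiv.swap 0 1) e n := by
  have h0 : ∀ m, 2 ≤ m → Equiv.swap 0 1 m = m := fun m hm =>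
    Equiv.swap_apply_of_ne_of_ne (by omega) (by omega)
  have hlt : ∀ j m, 2 ≤ m → j < m → Equiv.swap 0 1 j < m := by
    intro j m hm hj
    rw [Equiv.swap_apply_def]
    split_ifs <;> omega
  have hn := hT.one_le
  refine ⟨hn, hT.first, ?_, ?_, ?_⟩
  · intro i hi j hj hij
    exact (Equiv.swap 0 1).injective (hT.inj _ (by have := hlt i (n + 1) (by omega); omega) _
      (by have := hlt j (n + 1) (by omega); omega) hij)
  · intro m h1 hm
    obtain ⟨j, hj, hs⟩ := hT.attach m h1 hm
    rcases h1.lt_or_eq with h2 | rfl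
    · refine ⟨Equiv.swap 0 1 j, hlt j m h2 hj, ?_⟩
      rw [Function.comp_apply, Function.comp_apply, Equiv.swap_apply_self, h0 m h2, hs]
    · obtain rfl : j = 0 := by omega
      refine ⟨0, hj, ?_⟩
      rw [Function.comp_apply, Function.comp_apply, Equiv.swap_apply_left, Equiv.swap_apply_right,
        hs, Sym2.eq_swap]
  · intro m h2 hm
    obtain ⟨c, hc, j, hj, hcj⟩ := hT.color m h2 hm
    refine ⟨c, hc, Equiv.swap 0 1 j, hlt j m h2 hj, ?_⟩
    rwa [Function.comp_apply, Equiv.swap_apply_self]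

/-- The last two vertices cannot share a color if the tree ends with a path edge. -/
theorem false_of_shared_path_end (hK : IsStuckFamily 𝒦 g) (hφ : φ ∈ 𝒦)
    (hT : IsTashkinovSeq φ g y e n) (hn : 2 ≤ n)
    (hel : ∀ m < n, ∀ ψ ∈ 𝒦, IsTashkinovSeq ψ g y e m → IsElemSeq ψ y m)
    (hends : G.ends (e n) = s(y (n - 1), y n)) {α : ℕ} (hα1 : α ∈ φ.missing (y (n - 1)))
    (hαn : α ∈ φ.missing (y n)) : False := by
  obtain ⟨β, hβ, j, hj, hβj⟩ := hT.color n hn le_rfl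
  have hmem : y (n - 1) ∈ G.ends (e n) := by rw [hends]; exact Sym2.mem_mk_left _ _
  have hmem' : y n ∈ G.ends (e n) := by rw [hends]; exact Sym2.mem_mk_right _ _
  have hj1 : j < n - 1 := by
    rcases Nat.lt_or_ge j (n - 1) with h | h
    · exact h
    · obtain rfl : j = n - 1 := by omega
      exact absurd hβ (hβj.2 _ hmem)
  have hadj : (φ.chainGraph α β).Adj (y (n - 1)) (y n) := chainGraph_adj_of_ends (.inr hβ) hends
  have hsub : φ.chain α β (y n) ⊆ {y (n - 1), y n} := by
    refine chain_subset_of_closed (.inr rfl) ?_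
    rintro x (rfl | rfl) b hb
    · exact .inr (chainGraph_adj_unique (.inl hα1) hb hadj)
    · exact .inl (chainGraph_adj_unique (.inl hαn) hb hadj.symm)
  have hout : ∀ l < n - 1, y l ∉ φ.chain α β (y n) := by
    intro l hl hc
    rcases hsub hc with h | h
    · have := hT.inj l (by omega) _ (by omega) h
      omega
    · have := hT.inj l (by omega) n le_rfl h
      omega
  have hT' : IsTashkinovSeq (φ.chainSwap hα1.1 hβj.1 (y n)) g y e (n - 1) := by
    refine ⟨by omega, hT.first, (hT.take (by omega) (by omega)).inj,
      (hT.take (by omega) (by omega)).attach, ?_⟩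
    intro m h2 hm
    obtain ⟨c, hc, i, hi, hci⟩ := hT.color m h2 (by omega)
    obtain ⟨l, hl, hlm⟩ := hT.left_mem (m := m) (by omega) (by omega)
    refine ⟨c, ?_, i, hi, (mem_missing_chainSwap_of_notMem (hout i (by omega))).mpr hci⟩
    rw [chainSwap_map_of_notMem hlm (hout l (by omega)), hc]
  exact hel (n - 1) (by omega) _ (hK.swap φ hφ _ _ _ _ _) hT' j (n - 1) hj1 le_rfl β
    ((mem_missing_chainSwap_of_notMem (hout j hj1)).mpr hβj)
    (right_mem_missing_chainSwap (mem_chain_comm.mp hadj.reachable) hα1)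

section main

variable [Fintype E] [DecidableEq V]

/-- The last two vertices cannot share a color if `e n` attaches `y n` to the tree up to
`y (n - 2)` and has a color missing there. -/
theorem false_of_shared_skip (hk : ∀ v, G.degree v < k) (hK : IsStuckFamily 𝒦 g) (hφ : φ ∈ 𝒦)
    (hT : IsTashkinovSeq φ g y e n) (hn : 3 ≤ n)
    (hlow : ∀ q < n, ∀ n' y' e', ∀ ψ ∈ 𝒦, IsTashkinovSeq ψ g y' e' n' →
      IsPathFrom G y' e' q n' → IsElemSeq ψ y' n')
    (hel : ∀ m < n, ∀ ψ ∈ 𝒦, IsTashkinovSeq ψ g y e m → IsElemSeq ψ y m)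
    {l j α β : ℕ} (hl : l ≤ n - 2) (hends : G.ends (e n) = s(y l, y n))
    (hβ : φ.map (e n) = some β) (hj : j ≤ n - 2) (hβj : β ∈ φ.missing (y j))
    (hα1 : α ∈ φ.missing (y (n - 1))) (hαn : α ∈ φ.missing (y n)) : False := by
  have hel1 := hel (n - 1) (by omega) φ hφ (hT.take (by omega) (by omega))
  obtain ⟨γ, hγβ, ⟨i, hi, hγi⟩, hγ⟩ := exists_missing_isUnused hk (hK.uncolored φ hφ) hT
    (r := n - 2) (by omega) (hel1.mono (by omega)) (n - 1) {β}
    (by rw [Finset.card_singleton]; omega)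
  rw [Finset.mem_singleton] at hγβ
  obtain ⟨hT', hγi', hγn'⟩ := isTashkinovSeq_swap_last hK hφ hT hel (r := n - 1) le_rfl
    (by omega) (by omega) hα1 hγi hαn (hT.isUnused (by omega) hel1 hα1) hγ
  have hβα : β ≠ α := by
    rintro rfl
    exact hαn.2 _ (hT.right_mem (by omega) le_rfl) hβ
  have hβ' : (φ.chainSwap hα1.1 hγi.1 (y n)).map (e n) = some β := by
    rw [chainSwap_map_of_ne, hβ]
    · rw [hβ]; simpa using hβα
    · rw [hβ]; simpa using Ne.symm hγβ
  have hskip := hT'.skip hn hl hends hβ' hj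
    ((mem_missing_chainSwap_of_ne hβα (Ne.symm hγβ)).mpr hβj)
  refine hlow (n - 1) (by omega) _ _ _ _ (hK.swap φ hφ _ _ _ _ _) hskip
    (fun m h1 h2 => by omega) i (n - 1) (by omega) le_rfl γ ?_ ?_
  · rwa [Function.update_of_ne (by omega)]
  · rwa [Function.update_self]

/-- The last two vertices cannot share a color if `e n` attaches `y n` to the tree up to
`y (n - 2)`. -/
theorem false_of_shared_branch_end (hk : ∀ v, G.degree v < k) (hK : IsStuckFamily 𝒦 g)
    (hφ : φ ∈ 𝒦) (hT : IsTashkinovSeq φ g y e n) (hn : 3 ≤ n)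
    (hlow : ∀ q < n, ∀ n' y' e', ∀ ψ ∈ 𝒦, IsTashkinovSeq ψ g y' e' n' →
      IsPathFrom G y' e' q n' → IsElemSeq ψ y' n')
    (hel : ∀ m < n, ∀ ψ ∈ 𝒦, IsTashkinovSeq ψ g y e m → IsElemSeq ψ y m)
    {l α : ℕ} (hl : l ≤ n - 2) (hends : G.ends (e n) = s(y l, y n))
    (hα1 : α ∈ φ.missing (y (n - 1))) (hαn : α ∈ φ.missing (y n)) : False := by
  obtain ⟨β, hβ, j, hj, hβj⟩ := hT.color n (by omega) le_rfl
  by_cases hj2 : j ≤ n - 2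
  · exact false_of_shared_skip hk hK hφ hT hn hlow hel hl hends hβ hj2 hβj hα1 hαn
  obtain rfl : j = n - 1 := by omega
  have hel1 := hel (n - 1) (by omega) φ hφ (hT.take (by omega) (by omega))
  obtain ⟨γ, hγβ, ⟨i, hi, hγi⟩, hγ⟩ := exists_missing_isUnused hk (hK.uncolored φ hφ) hT
    (r := n - 2) (by omega) (hel1.mono (by omega)) (n - 1) {β}
    (by rw [Finset.card_singleton]; omega)
  rw [Finset.mem_singleton] at hγβ
  have hα := hT.isUnused (by omega) hel1 hα1
  obtain ⟨hT', hγi', hγn'⟩ := isTashkinovSeq_swap_last hK hφ hT hel (r := n - 1) le_rfl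
    (by omega) (by omega) hα1 hγi hαn hα hγ
  have hβα : β ≠ α := by
    rintro rfl
    exact hαn.2 _ (hT.right_mem (by omega) le_rfl) hβ
  have hβ' : (φ.chainSwap hα1.1 hγi.1 (y n)).map (e n) = some β := by
    rw [chainSwap_map_of_ne, hβ]
    · rw [hβ]; simpa using hβα
    · rw [hβ]; simpa using Ne.symm hγβ
  have hβj' := (mem_missing_chainSwap_of_ne (φ := φ) (hα := hα1.1) (hβ := hγi.1) (v := y n)
    hβα (Ne.symm hγβ)).mpr hβj
  have hγ' : IsUnused (φ.chainSwap hα1.1 hγi.1 (y n)) e (n - 1) γ := hα.chainSwap hγ hγ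
  have hφ' : φ.chainSwap hα1.1 hγi.1 (y n) ∈ 𝒦 := hK.swap φ hφ _ _ _ _ _
  generalize φ.chainSwap hα1.1 hγi.1 (y n) = ψ at *
  have hT1 := hT'.take (m := n - 1) (by omega) (by omega)
  have hβu := hT1.isUnused le_rfl (hel (n - 1) (by omega) ψ hφ' hT1) hβj'
  have hchain := mem_chain_of_isUnused hK hφ' hT1 (hel (n - 1) (by omega)) (by omega) hγi' hβj' hγ'
  have hnot : y n ∉ ψ.chain γ β (y (n - 1)) :=
    notMem_chain_of_two_ends (fun h => by have := hT.inj _ (by omega) i (by omega) h; omega)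
      (fun h => by have := hT.inj _ (by omega) n le_rfl h; omega)
      (fun h => by have := hT.inj i (by omega) n le_rfl h; omega)
      (.inr hβj') (.inl hγi') (.inl hγn') hchain
  have hγ1 : γ ∈ (ψ.chainSwap hγi'.1 hβj'.1 (y (n - 1))).missing (y (n - 1)) :=
    left_mem_missing_chainSwap (mem_chain_self _ _ _ _) hβj'
  have hβi : β ∈ (ψ.chainSwap hγi'.1 hβj'.1 (y (n - 1))).missing (y i) :=
    right_mem_missing_chainSwap hchain hγi'
  refine false_of_shared_skip hk hK (hK.swap ψ hφ' _ _ hγi'.1 hβj'.1 (y (n - 1)))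
    (hT'.chainSwap (r := n - 1) hγ' hβu (fun _ => ⟨n - 1, le_rfl, hγ1⟩)
      (fun _ => ⟨i, by omega, hβi⟩)) hn hlow hel hl hends (β := β) ?_ hi hβi hγ1
    ((mem_missing_chainSwap_of_notMem hnot).mpr hγn')
  rw [chainSwap_map_of_notMem (hT.right_mem (by omega) le_rfl) hnot, hβ']

/-- A color shared by `y i` and `y n`, where `e (i + 1)` has that color and `i + 1 < p`, can be
traded for one shared by `y (i + 1)` and `y n`. -/
theorem exists_shared_succ_of_lt (hk : ∀ v, G.degree v < k) (hK : IsStuckFamily 𝒦 g)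
    (hφ : φ ∈ 𝒦) (hT : IsTashkinovSeq φ g y e n) {p i α : ℕ}
    (hlow : ∀ q < p, ∀ n' y' e', ∀ ψ ∈ 𝒦, IsTashkinovSeq ψ g y' e' n' →
      IsPathFrom G y' e' q n' → IsElemSeq ψ y' n')
    (hel : ∀ m < n, ∀ ψ ∈ 𝒦, IsTashkinovSeq ψ g y e m → IsElemSeq ψ y m)
    (hi1 : 1 ≤ i) (hip : i + 1 < p) (hin : i + 1 < n)
    (hαi : α ∈ φ.missing (y i)) (hαn : α ∈ φ.missing (y n)) (hα : φ.map (e (i + 1)) = some α) :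
    ∃ ψ ∈ 𝒦, IsTashkinovSeq ψ g y e n ∧
      ∃ c ∈ ψ.missing (y (i + 1)), c ∈ ψ.missing (y n) := by
  have heli := hel i (by omega) φ hφ (hT.take hi1 (by omega))
  obtain ⟨γ, hγα, ⟨j, hj, hγj⟩, hγ⟩ := exists_missing_isUnused hk (hK.uncolored φ hφ) hT hi1
    heli i {α} (by rw [Finset.card_singleton]; omega)
  rw [Finset.mem_singleton] at hγα
  have hαu := hT.isUnused (by omega) heli hαi
  obtain ⟨hT', hγj', hγn'⟩ := isTashkinovSeq_swap_last hK hφ hT hel le_rfl hj (by omega)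
    hαi hγj hαn hαu hγ
  obtain ⟨l, hl, hlm⟩ := hT.left_mem (m := i + 1) (by omega) (by omega)
  have hout := notMem_chain_of_lt hφ hT hlow hi1 hip (by omega) le_rfl hj (m := l) (by omega)
    hαi hγj hαn
  refine exists_shared_of_isUnused hK (hK.swap φ hφ _ _ _ _ _) hT' hel
    (missing_nonempty hk _ _) (by omega) hin hγj' hγn' ((hαu.chainSwap hγ hγ).succ ?_)
  rw [chainSwap_map_of_notMem hlm hout, hα]
  simpa using Ne.symm hγα

/-- A color shared by `y (p - 1)` and `y n`, where `e p` has that color and attaches `y p` to the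
tree up to `y (p - 2)`, can be traded for one shared by `y p` and `y n`. -/
theorem exists_shared_branch (hk : ∀ v, G.degree v < k) (hK : IsStuckFamily 𝒦 g)
    (hφ : φ ∈ 𝒦) (hT : IsTashkinovSeq φ g y e n) {p l α : ℕ}
    (hlow : ∀ q < p, ∀ n' y' e', ∀ ψ ∈ 𝒦, IsTashkinovSeq ψ g y' e' n' →
      IsPathFrom G y' e' q n' → IsElemSeq ψ y' n')
    (hel : ∀ m < n, ∀ ψ ∈ 𝒦, IsTashkinovSeq ψ g y e m → IsElemSeq ψ y m)
    (hp : 3 ≤ p) (hpn : p < n) (hl : l ≤ p - 2) (hends : G.ends (e p) = s(y l, y p))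
    (hα1 : α ∈ φ.missing (y (p - 1))) (hαn : α ∈ φ.missing (y n)) (hα : φ.map (e p) = some α) :
    ∃ ψ ∈ 𝒦, IsTashkinovSeq ψ g y e n ∧ ∃ c ∈ ψ.missing (y p), c ∈ ψ.missing (y n) := by
  have hsucc : p - 1 + 1 = p := by omega
  have hel1 := hel (p - 1) (by omega) φ hφ (hT.take (by omega) (by omega))
  obtain ⟨γ, -, ⟨j, hj, hγj⟩, hγ⟩ := exists_missing_isUnused hk (hK.uncolored φ hφ) hT
    (r := p - 2) (by omega) (hel1.mono (by omega)) (p - 1) ∅ (by rw [Finset.card_empty]; omega)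
  obtain ⟨γ', hγγ', ⟨j', hj', hγj'⟩, hγ'⟩ := exists_missing_isUnused hk (hK.uncolored φ hφ) hT
    (r := p - 2) (by omega) (hel1.mono (by omega)) (p - 1) {γ}
    (by rw [Finset.card_singleton]; omega)
  rw [Finset.mem_singleton] at hγγ'
  have hγ'α : γ' ≠ α := by
    rintro rfl
    exact hel1 j' (p - 1) (by omega) le_rfl _ hγj' hα1
  have hαu := hT.isUnused (by omega) hel1 hα1
  obtain ⟨hT1, hγj1, hγn1⟩ := isTashkinovSeq_swap_last hK hφ hT hel (r := p - 1) le_rfl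
    (by omega) (by omega) hα1 hγj hαn hαu hγ
  have hφ1 : φ.chainSwap hα1.1 hγj.1 (y n) ∈ 𝒦 := hK.swap φ hφ _ _ _ _ _
  have hγ1 : IsUnused (φ.chainSwap hα1.1 hγj.1 (y n)) e (p - 1) γ := hαu.chainSwap hγ hγ
  have hγ'1 : IsUnused (φ.chainSwap hα1.1 hγj.1 (y n)) e (p - 1) γ' := hαu.chainSwap hγ hγ'
  have hγj'1 := (mem_missing_chainSwap_of_ne (φ := φ) (hα := hα1.1) (hβ := hγj.1) (v := y n)
    hγ'α hγγ').mpr hγj'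
  generalize φ.chainSwap hα1.1 hγj.1 (y n) = ψ at *
  by_cases hep : ψ.map (e p) = some γ
  · obtain ⟨hT2, hγj2, hγn2⟩ := isTashkinovSeq_swap_last hK hφ1 hT1 hel (r := p - 1)
      (by omega) (by omega) (by omega) hγj1 hγj'1 hγn1 hγ1 hγ'1
    have hout := notMem_chain_of_lt hφ1 hT1 hlow (r := p - 2) (by omega) (by omega) (by omega)
      hj hj' hl hγj1 hγj'1 hγn1
    refine exists_shared_of_isUnused hK (hK.swap ψ hφ1 _ _ _ _ _) hT2 hel
      (missing_nonempty hk _ _) (by omega) hpn hγj2 hγn2 ?_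
    have hu := IsUnused.succ (hγ1.chainSwap (hα := hγj1.1) (hβ := hγj'1.1) (v := y n)
      hγ'1 hγ'1)
    rw [hsucc] at hu
    refine hu ?_
    rw [chainSwap_map_of_notMem (by rw [hends]; exact Sym2.mem_mk_left _ _) hout, hep]
    simpa using Ne.symm hγγ'
  · refine exists_shared_of_isUnused hK hφ1 hT1 hel (missing_nonempty hk _ _)
      (by omega) hpn hγj1 hγn1 ?_
    have hu := hγ1.succ
    rw [hsucc] at hu
    exact hu hep

/-- No vertex shares a missing color with the last vertex of a minimal Tashkinov tree. -/
theorem false_of_shared_last (hk : ∀ v, G.degree v < k) (hK : IsStuckFamily 𝒦 g) {p : ℕ}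
    (hn : 2 ≤ n) (hpath : IsPathFrom G y e p n)
    (hp : p = 0 ∨ (3 ≤ p ∧ p ≤ n ∧ ∃ l ≤ p - 2, G.ends (e p) = s(y l, y p)))
    (hlow : ∀ q < p, ∀ n' y' e', ∀ ψ ∈ 𝒦, IsTashkinovSeq ψ g y' e' n' →
      IsPathFrom G y' e' q n' → IsElemSeq ψ y' n')
    (hel : ∀ m < n, ∀ ψ ∈ 𝒦, IsTashkinovSeq ψ g y e m → IsElemSeq ψ y m) :
    ∀ d i, i + d + 1 = n → ∀ φ ∈ 𝒦, IsTashkinovSeq φ g y e n → ∀ α ∈ φ.missing (y i),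
      α ∉ φ.missing (y n) := by
  intro d
  induction d with
  | zero =>
    intro i hi φ hφ hT α hαi hαn
    obtain rfl : i = n - 1 := by omega
    rcases Nat.lt_or_ge p n with hpn | hpn
    · exact false_of_shared_path_end hK hφ hT hn hel (hpath n hpn le_rfl) hαi hαn
    · rcases hp with rfl | ⟨hp3, hpn', l, hl, hends⟩
      · omega
      · obtain rfl : p = n := le_antisymm hpn' hpn
        exact false_of_shared_branch_end hk hK hφ hT hp3 hlow hel hl hends hαi hαn
  | succ d ih =>
    intro i hi φ hφ hT α hαi hαn
    suffices h : ∃ ψ ∈ 𝒦, IsTashkinovSeq ψ g y e n ∧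
        ∃ c ∈ ψ.missing (y (i + 1)), c ∈ ψ.missing (y n) by
      obtain ⟨ψ, hψ, hTψ, c, hc1, hcn⟩ := h
      exact ih (i + 1) (by omega) ψ hψ hTψ c hc1 hcn
    by_cases hα : φ.map (e (i + 1)) = some α
    · have hi1 : 1 ≤ i := by
        by_contra h0
        obtain rfl : i = 0 := by omega
        rw [Nat.zero_add, hT.first, hK.uncolored φ hφ] at hα
        simp at hα
      have hip : i + 1 ≤ p := by
        by_contra h
        refine hαi.2 (e (i + 1)) ?_ hα
        rw [hpath (i + 1) (by omega) (by omega)]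
        exact Sym2.mem_mk_left _ _
      rcases hip.lt_or_eq with h | h
      · exact exists_shared_succ_of_lt hk hK hφ hT hlow hel hi1 h (by omega) hαi hαn hα
      · rcases hp with rfl | ⟨hp3, hpn', l, hl, hends⟩
        · omega
        · subst h
          exact exists_shared_branch hk hK hφ hT hlow hel hp3 (by omega) hl hends hαi hαn hα
    · have hTi := hT.take (m := i + 1) (by omega) (by omega)
      have hu : IsUnused φ e i α :=
        hTi.isUnused (by omega) ((hel (i + 1) (by omega) φ hφ hTi).mono (by omega)) hαi
      exact exists_shared_of_isUnused hK hφ hT hel (missing_nonempty hk _ _) (by omega)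
        (by omega) hαi hαn (hu.succ hα)

/-- **Tashkinov's theorem** for a family of colorings closed under chain swaps. -/
theorem isElemSeq_of_isPathFrom (hk : ∀ v, G.degree v < k) (hK : IsStuckFamily 𝒦 g) :
    ∀ p n y e, ∀ φ ∈ 𝒦, IsTashkinovSeq φ g y e n → IsPathFrom G y e p n → IsElemSeq φ y n := by
  intro p
  induction p using Nat.strong_induction_on with
  | _ p hlow =>
  intro n
  induction n using Nat.strong_induction_on with
  | _ n ihn =>
  intro y e φ hφ hT hpath
  by_cases hn : n = 1
  · subst hn
    intro i j hij hj c hci hcj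
    obtain rfl : j = 1 := by omega
    obtain rfl : i = 0 := by omega
    obtain ⟨l, hl, hs⟩ := hT.attach 1 le_rfl le_rfl
    obtain rfl : l = 0 := by omega
    rw [hT.first] at hs
    exact hK.disjoint φ hφ _ _ hs c hci hcj
  have hn2 : 2 ≤ n := by have := hT.one_le; omega
  by_cases hpn : n < p
  · exact hlow n hpn n y e φ hφ hT fun m h1 h2 => by omega
  have hel : ∀ m < n, ∀ ψ ∈ 𝒦, IsTashkinovSeq ψ g y e m → IsElemSeq ψ y m :=
    fun m hm ψ hψ hTψ => ihn m hm y e ψ hψ hTψ fun t h1 h2 => hpath t h1 (by omega)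
  have hlast : (p = 0 ∨ (3 ≤ p ∧ p ≤ n ∧ ∃ l ≤ p - 2, G.ends (e p) = s(y l, y p))) →
      IsElemSeq φ y n := by
    intro hp i j hij hj c hci hcj
    rcases hj.lt_or_eq with hj | rfl
    · exact hel j hj φ hφ (hT.take (by omega) hj.le) i j hij le_rfl c hci hcj
    · exact false_of_shared_last hk hK hn2 hpath hp hlow hel (j - i - 1) i (by omega) φ hφ hT c
        hci hcj
  rcases Nat.eq_zero_or_pos p with h0 | h0
  · exact hlast (.inl h0)
  obtain ⟨l, hl, hs⟩ := hT.attach p h0 (by omega)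
  by_cases hl1 : l = p - 1
  · refine hlow (p - 1) (by omega) n y e φ hφ hT fun m h1 h2 => ?_
    rcases Nat.lt_or_ge p m with h | h
    · exact hpath m h h2
    · obtain rfl : m = p := by omega
      rw [hs, hl1]
  by_cases hp3 : 3 ≤ p
  · exact hlast (.inr ⟨hp3, by omega, l, by omega, hs⟩)
  obtain rfl : p = 2 := by omega
  obtain rfl : l = 0 := by omega
  have hTs := hT.swap_first
  have hsw : ∀ m, 2 ≤ m → Equiv.swap 0 1 m = m := fun m hm =>
    Equiv.swap_apply_of_ne_of_ne (by omega) (by omega)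
  have hpath' : IsPathFrom G (y ∘ Equiv.swap 0 1) e 0 n := by
    intro m h1 h2
    rcases Nat.lt_or_ge 2 m with h | h
    · rw [Function.comp_apply, Function.comp_apply, hsw m (by omega), hsw (m - 1) (by omega)]
      exact hpath m h h2
    · rcases h.lt_or_eq with h | rfl
      · obtain rfl : m = 1 := by omega
        obtain ⟨t, ht, hst⟩ := hTs.attach 1 le_rfl (by omega)
        obtain rfl : t = 0 := by omega
        exact hst
      · rw [hs, Function.comp_apply, Function.comp_apply, hsw 2 le_rfl, Equiv.swap_apply_right]
  have hels := hlow 0 (by omega) n _ e φ hφ hTs hpath'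
  intro i j hij hj c hci hcj
  have hlt : ∀ i ≤ n, Equiv.swap 0 1 i ≤ n := by
    intro i hi
    rw [Equiv.swap_apply_def]
    split_ifs <;> omega
  have hne : Equiv.swap 0 1 i ≠ Equiv.swap 0 1 j := (Equiv.swap 0 1).injective.ne hij.ne
  have hci' : c ∈ φ.missing ((y ∘ Equiv.swap 0 1) (Equiv.swap 0 1 i)) := by
    rwa [Function.comp_apply, Equiv.swap_apply_self]
  have hcj' : c ∈ φ.missing ((y ∘ Equiv.swap 0 1) (Equiv.swap 0 1 j)) := by
    rwa [Function.comp_apply, Equiv.swap_apply_self]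
  rcases Nat.lt_or_gt_of_ne hne with h | h
  · exact hels _ _ h (hlt j hj) c hci' hcj'
  · exact hels _ _ h (hlt i (by omega)) c hcj' hci'

end main

end Multigraph

namespace Multigraph

open PartialColoring

variable {V E : Type} {G : Multigraph V E} {k : ℕ} {φ : G.PartialColoring k} {g : E}

theorem IsTashkinovSeq.congr {y z : ℕ → V} {e : ℕ → E} {n : ℕ} (h : IsTashkinovSeq φ g y e n)
    (hyz : ∀ i ≤ n, z i = y i) : IsTashkinovSeq φ g z e n where
  one_le := h.one_le
  first := h.first
  inj i hi j hj hij := h.inj i hi j hj (by rwa [hyz i hi, hyz j hj] at hij)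
  attach m h1 hm := by
    obtain ⟨j, hj, he⟩ := h.attach m h1 hm
    exact ⟨j, hj, by rw [he, hyz j (by omega), hyz m hm]⟩
  color m h2 hm := by
    obtain ⟨c, hc, j, hj, hcj⟩ := h.color m h2 hm
    exact ⟨c, hc, j, hj, by rwa [hyz j (by omega)]⟩

theorem IsTashkinovSeq.extend {y : ℕ → V} {e : ℕ → E} {n : ℕ} (h : IsTashkinovSeq φ g y e n)
    (hnew : ∀ i ≤ n, y i ≠ y (n + 1)) (hattach : ∃ j ≤ n, G.ends (e (n + 1)) = s(y j, y (n + 1)))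
    (hcolor : ∃ c, φ.map (e (n + 1)) = some c ∧ ∃ j ≤ n, c ∈ φ.missing (y j)) :
    IsTashkinovSeq φ g y e (n + 1) where
  one_le := by omega
  first := h.first
  inj i hi j hj hij := by
    rcases Nat.le_succ_iff.mp hi with hi | rfl <;> rcases Nat.le_succ_iff.mp hj with hj | rfl
    · exact h.inj i hi j hj hij
    · exact absurd hij (hnew i hi)
    · exact absurd hij.symm (hnew j hj)
    · rfl
  attach m h1 hm := by
    rcases Nat.le_succ_iff.mp hm with hm | rfl
    · exact h.attach m h1 hm
    · obtain ⟨j, hj, he⟩ := hattach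
      exact ⟨j, by omega, he⟩
  color m h2 hm := by
    rcases Nat.le_succ_iff.mp hm with hm | rfl
    · exact h.color m h2 hm
    · obtain ⟨c, hc, j, hj, hcj⟩ := hcolor
      exact ⟨c, hc, j, by omega, hcj⟩

theorem treeVerts_take_succ {L : List E} {i : ℕ} (hi : i < L.length) :
    G.treeVerts (L.take (i + 1)) = G.treeVerts (L.take i) ∪ {v | v ∈ G.ends L[i]} := by
  ext v
  simp only [treeVerts, List.take_add_one, List.getElem?_eq_getElem hi, Option.toList_some,
    List.mem_append, List.mem_singleton, Set.mem_ofPred_eq, Set.mem_union, or_and_right, exists_or,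
    exists_eq_left]

/-- The vertices of a closure of a single edge can be listed as a Tashkinov tree. -/
theorem IsClosureOf.exists_isTashkinovSeq {L : List E} (hL : G.IsClosureOf φ [g] L) :
    ∃ y e, IsTashkinovSeq φ g y e L.length ∧ G.treeVerts L = {v | ∃ j ≤ L.length, v = y j} := by
  obtain ⟨⟨hne, -, huniq⟩, htake, hcol, -⟩ := hL
  have hpos : 0 < L.length := List.length_pos_iff.mpr hne
  have hkey : ∀ i, 1 ≤ i → i ≤ L.length →
      ∃ y, IsTashkinovSeq φ g y (fun m => L.getD (m - 1) g) i ∧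
        G.treeVerts (L.take i) = {v | ∃ j ≤ i, v = y j} := by
    intro i h1
    induction i, h1 using Nat.le_induction with
    | base =>
      intro _
      obtain ⟨a, b, hab⟩ : ∃ a b, G.ends g = s(a, b) := by
        induction h : G.ends g using Sym2.ind with
        | _ a b => exact ⟨a, b, rfl⟩
      have hne : a ≠ b := by
        have := G.loopless g
        rwa [hab, Sym2.mk_isDiag_iff] at this
      have hfirst : L.getD (1 - 1) g = g := by
        obtain ⟨x, l, rfl⟩ := List.exists_cons_of_length_pos hpos
        simpa using htake
      refine ⟨fun i => if i = 0 then a else b, ⟨le_rfl, hfirst, ?_, ?_, ?_⟩, ?_⟩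
      · intro i hi j hj hij
        by_contra hne'
        rcases Nat.le_one_iff_eq_zero_or_eq_one.mp hi with rfl | rfl <;>
          rcases Nat.le_one_iff_eq_zero_or_eq_one.mp hj with rfl | rfl <;> simp_all
      · intro m h1 h2
        obtain rfl : m = 1 := by omega
        exact ⟨0, by omega, by rw [hfirst, hab]; rfl⟩
      · intro m h2 h1
        omega
      · rw [show L.take 1 = [g] from htake]
        ext v
        simp only [treeVerts, List.mem_singleton, exists_eq_left, hab, Sym2.mem_iff,
          Set.mem_ofPred_eq]
        constructor
        · rintro (rfl | rfl)
          · exact ⟨0, by omega, rfl⟩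
          · exact ⟨1, le_rfl, rfl⟩
        · rintro ⟨j, -, rfl⟩
          split_ifs
          · exact Or.inl rfl
          · exact Or.inr rfl
    | succ i h1 ih =>
      intro hi
      obtain ⟨y, hy, hverts⟩ := ih (by omega)
      obtain ⟨v, ⟨hv, hvT⟩, hvu⟩ := huniq i hi h1
      obtain ⟨c, hc, hcT⟩ := hcol i hi h1
      simp only [List.get_eq_getElem] at hv hvu hc
      obtain ⟨w, hw⟩ := Sym2.mem_iff_exists.mp hv
      have hvw : v ≠ w := by
        have := G.loopless L[i]
        rwa [hw, Sym2.mk_isDiag_iff] at this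
      have hwT : w ∉ G.treeVerts (L.take i) := fun h =>
        hvw (hvu w ⟨by rw [hw]; exact Sym2.mem_mk_right v w, h⟩).symm
      rw [hverts] at hvT hwT
      obtain ⟨j, hj, rfl⟩ := hvT
      have hold : ∀ l ≤ i, Function.update y (i + 1) w l = y l := fun l hl =>
        Function.update_of_ne (by omega) _ _
      have hget : L.getD (i + 1 - 1) g = L[i] := by
        rw [Nat.add_sub_cancel, List.getD_eq_getElem _ _ hi]
      refine ⟨Function.update y (i + 1) w, (hy.congr hold).extend ?_ ?_ ?_, ?_⟩
      · intro l hl h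
        rw [hold l hl, Function.update_self] at h
        exact hwT ⟨l, hl, h.symm⟩
      · exact ⟨j, hj, by rw [hget, hw, hold j hj, Function.update_self]⟩
      · refine ⟨c, by rw [hget, hc], ?_⟩
        simp only [missingOn, hverts, Set.mem_iUnion] at hcT
        obtain ⟨_, ⟨l, hl, rfl⟩, hcl⟩ := hcT
        exact ⟨l, hl, by rwa [hold l hl]⟩
      · rw [treeVerts_take_succ hi, hverts, hw]
        ext x
        simp only [Set.mem_union, Set.mem_ofPred_eq, Sym2.mem_iff]
        constructor
        · rintro (⟨l, hl, rfl⟩ | rfl | rfl)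
          · exact ⟨l, by omega, (hold l hl).symm⟩
          · exact ⟨j, by omega, (hold j hj).symm⟩
          · exact ⟨i + 1, le_rfl, by rw [Function.update_self]⟩
        · rintro ⟨l, hl, rfl⟩
          rcases Nat.le_succ_iff.mp hl with hl | rfl
          · exact Or.inl ⟨l, hl, hold l hl⟩
          · exact Or.inr (Or.inr (by rw [Function.update_self]))
  obtain ⟨y, hy, hverts⟩ := hkey L.length hpos le_rfl
  exact ⟨y, _, hy, by rwa [List.take_length] at hverts⟩

theorem IsElemSeq.isElemOn {y : ℕ → V} {n : ℕ} (h : IsElemSeq φ y n) :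
    G.IsElemOn φ {v | ∃ j ≤ n, v = y j} := by
  rintro _ ⟨i, hi, rfl⟩ _ ⟨j, hj, rfl⟩ hij
  refine Set.eq_empty_of_forall_notMem fun c hc => ?_
  rcases lt_trichotomy i j with hlt | rfl | hlt
  · exact h i j hlt hj c hc.1 hc.2
  · exact hij rfl
  · exact h j i hlt hi c hc.2 hc.1

/-- Color the uncolored edge `g` with a color missing at both of its ends. -/
def PartialColoring.insertEdge [DecidableEq E] (φ : G.PartialColoring k) {c : ℕ} {a b : V}
    (hab : G.ends g = s(a, b)) (ha : c ∈ φ.missing a) (hb : c ∈ φ.missing b) :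
    G.PartialColoring k where
  map e := if e = g then some c else φ.map e
  mem_Icc e d h := by
    split_ifs at h
    · exact Option.some.inj h ▸ ha.1
    · exact φ.mem_Icc e d h
  proper e f d hef hadj he hf := by
    have hmiss : ∀ x ∈ G.ends g, c ∈ φ.missing x := by
      intro x hx
      rw [hab, Sym2.mem_iff] at hx
      rcases hx with rfl | rfl
      exacts [ha, hb]
    obtain ⟨x, hxe, hxf⟩ := hadj
    split_ifs at he hf with h1 h2 h2
    · exact hef (h1.trans h2.symm)
    · subst h1
      exact (hmiss x hxe).2 f hxf (hf.trans he.symm)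
    · subst h2
      exact (hmiss x hxf).2 e hxe (he.trans hf.symm)
    · exact φ.proper e f d hef ⟨x, hxe, hxf⟩ he hf

end Multigraph

open Multigraph in
/-- Let `G` be a multigraph, `g ∈ E(G)` and `φ` a partial `k`-edge-coloring of
`G − g` with `k = max {Δ(G)+1, Γ(G)}`. If `cl_φ(G[g])` is not `φ`-elementary,
then there is a partial `k`-edge-coloring `π` of `G` whose support is
`φ⁻¹([k]) ∪ {g}` and whose restriction to `G − g` is Kempe equivalent to `φ`. -/
theorem recoloring_lemma {V E : Type} [Fintype V] [Fintype E]
    [DecidableEq V] [DecidableEq E] (G : Multigraph V E) (g : E)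
    (φ : G.PartialColoring G.goldbergBound) (hg : φ.map g = none)
    (L : List E) (hL : G.IsClosureOf φ [g] L) (hne : ¬ G.IsElemTree φ L) :
    ∃ π : G.PartialColoring G.goldbergBound,
      π.support = insert g φ.support ∧
      ∃ π' : G.PartialColoring G.goldbergBound,
        (π'.map = fun e => if e = g then none else π.map e) ∧
        G.KempeEquiv φ π' := by
  by_contra hno
  have hK : IsStuckFamily {ψ | G.KempeEquiv φ ψ} g := by
    refine ⟨fun ψ hψ α β hα hβ v => ?_, fun ψ hψ => ?_, fun ψ hψ a b hab c ha hb => ?_⟩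
    · exact Relation.ReflTransGen.trans hψ (PartialColoring.kempeEquiv_chainSwap ψ hα hβ v)
    · exact (PartialColoring.kempeEquiv_map_eq_none hψ g).mpr hg
    · have hψg := (PartialColoring.kempeEquiv_map_eq_none hψ g).mpr hg
      refine hno ⟨ψ.insertEdge hab ha hb, ?_, ψ, ?_, hψ⟩
      · ext e
        by_cases he : e = g
        · simp [PartialColoring.support, PartialColoring.insertEdge, he]
        · simp [PartialColoring.support, PartialColoring.insertEdge, he,
            PartialColoring.kempeEquiv_map_eq_none hψ e]
      · ext1 e
        by_cases he : e = g
        · simp [he, hψg]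
        · simp [PartialColoring.insertEdge, he]
  obtain ⟨y, e, hT, hverts⟩ := hL.exists_isTashkinovSeq
  refine hne ?_
  rw [IsElemTree, hverts]
  exact (isElemSeq_of_isPathFrom degree_lt_goldbergBound hK L.length L.length y e φ
    Relation.ReflTransGen.refl hT fun m h1 h2 => by omega).isElemOn
end
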